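/- arXiv:physics/0311077 — 13 statements merged into one kernel-verified Lean document; each statement's English description precedes it below -/
import Mathlib

section
/- Let L be a positive integer and let f : ℤ × ℕ → ℝ satisfy f(m,n) = 0 for all |m| > L. Then f is non-propagating (y_f(m,n) = 0 for all |m| > L and all n ∈ ℕ) if and only if the sum of f along every outgoing characteristic vanishes, i.e.: for every integer c ≥ −L, Σ_{k ∈ ℕ, |c−k| ≤ L} f(c−k, k) = 0, and for every integer d ≤ L, Σ_{k ∈ ℕ, |d+k| ≤ L} f(d+k, k) = 0 (both sums are finite since k ranges over an interval of length at most 2L). -/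
/-- Displacement of the discrete lattice string with zero initial field under
forcing `f`: each forced displacement splits evenly into a right-traveling and a
left-traveling component. -/
noncomputable def latticeY (f : ℤ × ℕ → ℝ) (m : ℤ) (n : ℕ) : ℝ :=
  (1 / 2) * ∑ k ∈ Finset.range (n + 1),
    (f (m - ((n - k : ℕ) : ℤ), k) + f (m + ((n - k : ℕ) : ℤ), k))

/-- `f` is non-propagating for the region `|m| ≤ L`. -/
def NonProp (L : ℕ) (f : ℤ × ℕ → ℝ) : Prop :=
  ∀ m : ℤ, ∀ n : ℕ, (L : ℤ) < |m| → latticeY f m n = 0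

/-- To the right of the support, only the right-traveling component contributes, and it is the
full sum of `f` along the characteristic `m - n`. -/
theorem latticeY_of_lt (L : ℕ) (f : ℤ × ℕ → ℝ)
    (hsupp : ∀ m : ℤ, ∀ n : ℕ, (L : ℤ) < |m| → f (m, n) = 0)
    (m : ℤ) (n : ℕ) (hm : (L : ℤ) < m) :
    latticeY f m n = (1 / 2) *
      ∑ k ∈ (Finset.range (((L : ℤ) - (m - n)).toNat + 1)).filter
          (fun k : ℕ => |(m - n) + (k : ℤ)| ≤ (L : ℤ)),
        f ((m - n) + (k : ℤ), k) := by
  unfold latticeY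
  congr 1
  symm
  trans ∑ k ∈ Finset.range (n + 1), f ((m - n) + (k : ℤ), k)
  · refine Finset.sum_subset (fun k hk => ?_) (fun k hk hk' => hsupp _ _ ?_)
    · simp only [Finset.mem_filter, Finset.mem_range] at hk ⊢
      omega
    · simp only [Finset.mem_filter, Finset.mem_range, abs_le, not_and, lt_abs] at hk hk' ⊢
      omega
  · refine Finset.sum_congr rfl (fun k hk => ?_)
    rw [Finset.mem_range] at hk
    rw [hsupp (m + ((n - k : ℕ) : ℤ)) k (by rw [lt_abs]; omega), add_zero]
    congr 2
    omega

/-- To the left of the support, only the left-traveling component contributes, and it is the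
full sum of `f` along the characteristic `m + n`. -/
theorem latticeY_of_lt_neg (L : ℕ) (f : ℤ × ℕ → ℝ)
    (hsupp : ∀ m : ℤ, ∀ n : ℕ, (L : ℤ) < |m| → f (m, n) = 0)
    (m : ℤ) (n : ℕ) (hm : m < -(L : ℤ)) :
    latticeY f m n = (1 / 2) *
      ∑ k ∈ (Finset.range (((m + n) + (L : ℤ)).toNat + 1)).filter
          (fun k : ℕ => |(m + n) - (k : ℤ)| ≤ (L : ℤ)),
        f ((m + n) - (k : ℤ), k) := by
  unfold latticeY
  congr 1
  symm
  trans ∑ k ∈ Finset.range (n + 1), f ((m + n) - (k : ℤ), k)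
  · refine Finset.sum_subset (fun k hk => ?_) (fun k hk hk' => hsupp _ _ ?_)
    · simp only [Finset.mem_filter, Finset.mem_range] at hk ⊢
      omega
    · simp only [Finset.mem_filter, Finset.mem_range, abs_le, not_and, lt_abs] at hk hk' ⊢
      omega
  · refine Finset.sum_congr rfl (fun k hk => ?_)
    rw [Finset.mem_range] at hk
    rw [hsupp (m - ((n - k : ℕ) : ℤ)) k (by rw [lt_abs]; omega), zero_add]
    congr 2
    omega

/-- `f` supported in `|m| ≤ L` is non-propagating iff the sum of `f`
along every outgoing characteristic vanishes. -/
theorem nonprop_iff_characteristic_sums_vanish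
    (L : ℕ) (hL : 1 ≤ L) (f : ℤ × ℕ → ℝ)
    (hsupp : ∀ m : ℤ, ∀ n : ℕ, (L : ℤ) < |m| → f (m, n) = 0) :
    NonProp L f ↔
      ((∀ c : ℤ, -(L : ℤ) ≤ c →
          ∑ k ∈ (Finset.range ((c + L).toNat + 1)).filter
              (fun k : ℕ => |c - (k : ℤ)| ≤ (L : ℤ)),
            f (c - (k : ℤ), k) = 0) ∧
       (∀ d : ℤ, d ≤ (L : ℤ) →
          ∑ k ∈ (Finset.range (((L : ℤ) - d).toNat + 1)).filter
              (fun k : ℕ => |d + (k : ℤ)| ≤ (L : ℤ)),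
            f (d + (k : ℤ), k) = 0)) := by
  constructor
  · intro h
    refine ⟨fun c hc => ?_, fun d hd => ?_⟩
    · obtain ⟨n, hn⟩ := Int.eq_ofNat_of_zero_le (show 0 ≤ c + L + 1 by omega)
      have hy := h (-(L : ℤ) - 1) n (by rw [lt_abs]; omega)
      rw [latticeY_of_lt_neg L f hsupp _ n (by omega),
        show -(L : ℤ) - 1 + n = c by omega] at hy
      linarith
    · obtain ⟨n, hn⟩ := Int.eq_ofNat_of_zero_le (show 0 ≤ (L : ℤ) + 1 - d by omega)
      have hy := h ((L : ℤ) + 1) n (by rw [lt_abs]; omega)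
      rw [latticeY_of_lt L f hsupp _ n (by omega),
        show (L : ℤ) + 1 - n = d by omega] at hy
      linarith
  · rintro ⟨hc, hd⟩ m n hm
    rcases lt_abs.mp hm with hm | hm
    · rw [latticeY_of_lt L f hsupp m n hm]
      by_cases h : m - n ≤ (L : ℤ)
      · rw [hd _ h, mul_zero]
      · rw [Finset.sum_eq_zero, mul_zero]
        intro k _
        exact hsupp _ _ (by rw [lt_abs]; omega)
    · rw [latticeY_of_lt_neg L f hsupp m n (by omega)]
      by_cases h : -(L : ℤ) ≤ m + n
      · rw [hc _ h, mul_zero]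
      · rw [Finset.sum_eq_zero, mul_zero]
        intro k _
        exact hsupp _ _ (by rw [lt_abs]; omega)
end

section
/- Let L be a positive integer, p an integer with p > −L, and a ∈ ℝ. Define f : ℤ × ℕ → ℝ by f(p,0) = a, f(−L, L+p) = −a, and f = 0 elsewhere. Then: (i) y_f(m,n) = 0 for all m < −L and all n ∈ ℕ (nothing escapes to the left); and (ii) for all n ≥ L+p and all m, y_f(m,n) = (a/2) if m−n = p, −(a/2) if m−n = −2L−p, and 0 otherwise; that is, the matched forced displacement at the boundary −L reflects the incoming left-traveling half-pulse into a right-traveling half-pulse with inverted sign. -/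
/-- A sum over `range (n + 1)` of a function supported at `0` and at a positive `N`. -/
theorem sum_range_succ_eq_of_support_pair (n N : ℕ) (hN : 0 < N) (g : ℕ → ℝ)
    (hg : ∀ k, k ≠ 0 → k ≠ N → g k = 0) :
    ∑ k ∈ Finset.range (n + 1), g k = g 0 + if N ≤ n then g N else 0 := by
  have hsplit : ∀ k, g k = (if k = 0 then g 0 else 0) + if k = N then g N else 0 := by
    intro k
    by_cases h0 : k = 0
    · subst h0
      simp [hN.ne]
    · by_cases hkN : k = N
      · subst hkN
        simp [h0]
      · simp [h0, hkN, hg k h0 hkN]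
  rw [Finset.sum_congr rfl fun k _ => hsplit k, Finset.sum_add_distrib]
  simp [Finset.sum_ite_eq']

/-- a matched forced displacement at the boundary `-L` reflects the
incoming left-traveling half-pulse into a right-traveling half-pulse with
inverted sign, and nothing escapes to the left. -/
theorem matched_boundary_force_reflects
    (L : ℕ) (hL : 1 ≤ L) (p : ℤ) (hp : -(L : ℤ) < p) (a : ℝ)
    (f : ℤ × ℕ → ℝ)
    (hf : ∀ m : ℤ, ∀ n : ℕ,
      f (m, n) = if m = p ∧ n = 0 then a
        else if m = -(L : ℤ) ∧ (n : ℤ) = (L : ℤ) + p then -a else 0) :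
    (∀ m : ℤ, ∀ n : ℕ, m < -(L : ℤ) → latticeY f m n = 0) ∧
    (∀ n : ℕ, (L : ℤ) + p ≤ (n : ℤ) → ∀ m : ℤ,
      latticeY f m n =
        if m - (n : ℤ) = p then a / 2
        else if m - (n : ℤ) = -2 * (L : ℤ) - p then -a / 2 else 0) := by
  obtain ⟨N, hN⟩ := Int.eq_ofNat_of_zero_le (show 0 ≤ (L : ℤ) + p by omega)
  have hNpos : 0 < N := by omega
  have hY : ∀ m : ℤ, ∀ n : ℕ, latticeY f m n = (1 / 2) *
      (((if m - n = p then a else 0) + (if m + n = p then a else 0)) +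
        if N ≤ n then
          (if m - n = -2 * (L : ℤ) - p then -a else 0) + (if m + n = p then -a else 0)
        else 0) := by
    intro m n
    rw [latticeY, sum_range_succ_eq_of_support_pair n N hNpos]
    · simp only [hf, and_true]
      refine congrArg₂ _ rfl (congrArg₂ _ (congrArg₂ _ ?_ ?_) ?_)
      · split_ifs <;> first | rfl | omega
      · split_ifs <;> first | rfl | omega
      · refine ite_congr rfl (fun h => congrArg₂ _ ?_ ?_) fun _ => rfl
        · split_ifs <;> first | rfl | omega
        · split_ifs <;> first | rfl | omega
    · intro k hk0 hkN
      have hk : (k : ℤ) ≠ (L : ℤ) + p := by omega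
      simp [hf, hk0, hk]
  refine ⟨fun m n hm => ?_, fun n hn m => ?_⟩
  · rw [hY]
    split_ifs <;> first | omega | ring
  · rw [hY]
    split_ifs <;> first | omega | ring
end

section
/- Let L ≥ 1 and p be integers with |p| < L, let a ≠ 0 be real, and let f : ℤ × ℕ → ℝ satisfy f(p,0) = a, f(m,0) = 0 for m ≠ p, and f(m,n) = 0 for every n ≥ 1 and every m ∉ {−L, L}. If f is non-propagating, then the set { n ≥ 1 : f(−L,n) ≠ 0 or f(L,n) ≠ 0 } is infinite; that is, trapping a single interior impulse necessitates an infinite series of forced displacements at the region boundaries. -/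
/-- The forcing `f` is supported on an impulse at `(p, 0)`, and, at later times,
on the boundary points `±L`. -/
def BoundaryForced (L : ℕ) (p : ℤ) (f : ℤ × ℕ → ℝ) : Prop :=
  ∀ (m : ℤ) (k : ℕ), (k = 0 → m ≠ p) → (k ≠ 0 → m ≠ -(L : ℤ) ∧ m ≠ (L : ℤ)) → f (m, k) = 0

theorem BoundaryForced.sum_right_eq_zero {L : ℕ} {p : ℤ} {f : ℤ × ℕ → ℝ}
    (hf : BoundaryForced L p f) (hp : |p| < (L : ℤ)) (hnp : NonProp L f) (t : ℕ) :
    ∑ k ∈ Finset.range (t + 2), f ((L : ℤ) - t + k, k) = 0 := by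
  have h := hnp (L + 1) (t + 1) (by rw [abs_of_nonneg (by positivity)]; omega)
  rw [abs_lt] at hp
  rw [latticeY, mul_eq_zero, or_iff_right (by norm_num)] at h
  rw [← h]
  refine Finset.sum_congr rfl fun k hk => ?_
  rw [Finset.mem_range] at hk
  rw [hf (L + 1 + ((t + 1 - k : ℕ) : ℤ)) k (by omega) (by omega), add_zero]
  congr 2
  omega

theorem BoundaryForced.neg {L : ℕ} {p : ℤ} {f : ℤ × ℕ → ℝ} (hf : BoundaryForced L p f) :
    BoundaryForced L (-p) fun x => f (-x.1, x.2) :=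
  fun m k h0 h1 => hf (-m) k (by omega) (by omega)

theorem NonProp.neg {L : ℕ} {f : ℤ × ℕ → ℝ} (hf : NonProp L f) :
    NonProp L fun x => f (-x.1, x.2) := by
  intro m n hm
  rw [← hf (-m) n (by rwa [abs_neg]), latticeY, latticeY]
  congr 1
  refine Finset.sum_congr rfl fun k _ => ?_
  rw [add_comm]
  congr 3 <;> ring

theorem BoundaryForced.apply_add_two_mul {L : ℕ} {p : ℤ} {f : ℤ × ℕ → ℝ}
    (hf : BoundaryForced L p f) (hp : |p| < (L : ℤ)) (hnp : NonProp L f) {s : ℕ} (hs : 1 ≤ s) :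
    f (L, s + 2 * L) = -f (-L, s) := by
  have h := hf.sum_right_eq_zero hp hnp (s + 2 * L)
  rw [abs_lt] at hp
  rw [Finset.sum_eq_add (s + 2 * L) s (by omega)
    (fun k _ hk => hf _ _ (by omega) (by omega)) (fun hk => absurd (Finset.mem_range.2 (by omega)) hk)
    (fun hk => absurd (Finset.mem_range.2 (by omega)) hk)] at h
  rw [eq_neg_iff_add_eq_zero, ← h]
  congr 3 <;> push_cast <;> ring

theorem BoundaryForced.apply_first {L : ℕ} {p : ℤ} {f : ℤ × ℕ → ℝ}
    (hf : BoundaryForced L p f) (hp : |p| < (L : ℤ)) (hnp : NonProp L f) {t : ℕ}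
    (ht : (t : ℤ) = L - p) : f (L, t) = -f (p, 0) := by
  have h := hf.sum_right_eq_zero hp hnp t
  rw [abs_lt] at hp
  rw [Finset.sum_eq_add t 0 (by omega)
    (fun k _ hk => hf _ _ (by omega) (by omega)) (fun hk => absurd (Finset.mem_range.2 (by omega)) hk)
    (fun hk => absurd (Finset.mem_range.2 (by omega)) hk)] at h
  rw [eq_neg_iff_add_eq_zero, ← h]
  congr 3 <;> push_cast <;> omega

/-- trapping a single interior impulse necessitates an infinite
series of forced displacements at the region boundaries. -/
theorem trapping_needs_infinitely_many_boundary_forces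
    (L : ℕ) (hL : 1 ≤ L) (p : ℤ) (hp : |p| < (L : ℤ)) (a : ℝ) (ha : a ≠ 0)
    (f : ℤ × ℕ → ℝ)
    (hf0 : f (p, 0) = a)
    (hf0' : ∀ m : ℤ, m ≠ p → f (m, 0) = 0)
    (hbd : ∀ n : ℕ, 1 ≤ n → ∀ m : ℤ, m ≠ -(L : ℤ) → m ≠ (L : ℤ) → f (m, n) = 0)
    (hnp : NonProp L f) :
    {n : ℕ | 1 ≤ n ∧ (f (-(L : ℤ), n) ≠ 0 ∨ f ((L : ℤ), n) ≠ 0)}.Infinite := by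
  have hf : BoundaryForced L p f := by
    intro m k h0 h1
    rcases Nat.eq_zero_or_pos k with rfl | hk
    · exact hf0' m (h0 rfl)
    · exact hbd k hk m (h1 hk.ne').1 (h1 hk.ne').2
  obtain ⟨t, ht⟩ : ∃ t : ℕ, (t : ℤ) = L - p :=
    ⟨(L - p).toNat, Int.toNat_of_nonneg (by linarith [le_abs_self p])⟩
  have ht1 : 1 ≤ t := by linarith [le_abs_self p, show (1 : ℤ) ≤ t by linarith [le_abs_self p]]
  have periodic (j : ℕ) : f (L, t + 4 * L * j) = -a := by
    induction j with
    | zero => simpa [hf0] using hf.apply_first hp hnp ht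
    | succ j ih =>
      have h1 := hf.apply_add_two_mul hp hnp (s := t + 4 * L * j + 2 * L) (by omega)
      have h2 := hf.neg.apply_add_two_mul (by rwa [abs_neg]) hnp.neg
        (s := t + 4 * L * j) (by omega)
      simp only [neg_neg] at h2
      rw [show t + 4 * L * (j + 1) = t + 4 * L * j + 2 * L + 2 * L by ring, h1, h2, neg_neg, ih]
  refine Set.infinite_of_injective_forall_mem (f := fun j : ℕ => t + 4 * L * j) ?_ fun j =>
    ⟨by omega, Or.inr (by simpa [periodic j] using ha)⟩
  intro i j hij
  exact Nat.eq_of_mul_eq_mul_left (by omega : 0 < 4 * L) (Nat.add_left_cancel hij)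
end

section
/- Let L ≥ 1 and p be integers with |p| < L and let a ≠ 0 be real. Among all forcings f : ℤ × ℕ → ℝ with f(p,0) = a, f(m,0) = 0 for m ≠ p, and f(m,n) = 0 for every n ≥ 1 and m ∉ {−L, L}, there is exactly one that is non-propagating. Moreover this unique trapping forcing satisfies f(−L, n+2L) = −f(L, n) and f(L, n+2L) = −f(−L, n) for all n ≥ 1, and consequently its boundary values are periodic in time with period 4L: f(−L, n+4L) = f(−L, n) and f(L, n+4L) = f(L, n) for all n ≥ 1. -/
/-- `f` consists of a single impulse `a` at `(p, 0)` and later forces at `±L` only. -/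
def BoundaryForcing (L : ℕ) (p : ℤ) (a : ℝ) (f : ℤ × ℕ → ℝ) : Prop :=
  f (p, 0) = a ∧ (∀ m : ℤ, m ≠ p → f (m, 0) = 0) ∧
    (∀ n : ℕ, 1 ≤ n → ∀ m : ℤ, m ≠ -(L : ℤ) → m ≠ (L : ℤ) → f (m, n) = 0)

/-- The amplitude carried by `f` along the right-moving characteristic that leaves `L`
at time `j`. -/
def outgoingAmplitude (L : ℕ) (p : ℤ) (a : ℝ) (f : ℤ × ℕ → ℝ) (j : ℕ) : ℝ :=
  (if (j : ℤ) = L - p then a else 0) + f ((L : ℤ), j) +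
    (if 2 * L ≤ j then f (-(L : ℤ), j - 2 * L) else 0)

/-- Spatial reflection of a forcing. -/
def reflectForcing (f : ℤ × ℕ → ℝ) : ℤ × ℕ → ℝ := fun x => f (-x.1, x.2)

theorem latticeY_reflectForcing (f : ℤ × ℕ → ℝ) (m : ℤ) (n : ℕ) :
    latticeY (reflectForcing f) m n = latticeY f (-m) n := by
  unfold latticeY reflectForcing
  congr 1
  refine Finset.sum_congr rfl fun k _ => ?_
  rw [add_comm]
  congr 3 <;> ring

theorem BoundaryForcing.reflect {L : ℕ} {p : ℤ} {a : ℝ} {f : ℤ × ℕ → ℝ}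
    (h : BoundaryForcing L p a f) : BoundaryForcing L (-p) a (reflectForcing f) := by
  obtain ⟨h₁, h₂, h₃⟩ := h
  refine ⟨by simpa [reflectForcing] using h₁, fun m hm => h₂ _ ?_,
    fun n hn m hm hm' => h₃ n hn _ ?_ ?_⟩ <;> dsimp only <;> omega

theorem BoundaryForcing.eq_zero_of_lt_abs {L : ℕ} {p : ℤ} {a : ℝ} {f : ℤ × ℕ → ℝ}
    (hp : |p| < (L : ℤ)) (h : BoundaryForcing L p a f) {m : ℤ} (hm : (L : ℤ) < |m|) (n : ℕ) :
    f (m, n) = 0 := by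
  rcases Nat.eq_zero_or_pos n with rfl | hn
  · exact h.2.1 m (by grind)
  · exact h.2.2 n hn m (by grind) (by grind)

/-- Right of the region, only characteristics emitted before reaching the observer count. -/
theorem BoundaryForcing.latticeY_eq_zero {L : ℕ} {p : ℤ} {a : ℝ} {f : ℤ × ℕ → ℝ}
    (hp : |p| < (L : ℤ)) (h : BoundaryForcing L p a f) {m : ℤ} {n : ℕ} (hm : (L : ℤ) + n < m) :
    latticeY f m n = 0 := by
  unfold latticeY
  rw [Finset.sum_eq_zero, mul_zero]
  intro k hk
  rw [h.eq_zero_of_lt_abs hp (lt_abs.2 (Or.inl (by omega))),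
    h.eq_zero_of_lt_abs hp (lt_abs.2 (Or.inl (by omega))), add_zero]

theorem BoundaryForcing.latticeY_eq_outgoingAmplitude {L : ℕ} (hL : 1 ≤ L) {p : ℤ} {a : ℝ}
    {f : ℤ × ℕ → ℝ} (hp : |p| < (L : ℤ)) (h : BoundaryForcing L p a f) {m : ℤ} {n j : ℕ}
    (hm : (L : ℤ) < m) (hj : m + j = L + n) :
    latticeY f m n = (1 / 2) * outgoingAmplitude L p a f j := by
  have hpL := abs_lt.1 hp
  have key : ∀ k ∈ Finset.range (n + 1),
      f (m - ((n - k : ℕ) : ℤ), k) + f (m + ((n - k : ℕ) : ℤ), k) =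
        (if k = 0 then (if (j : ℤ) = L - p then a else 0) else 0) +
        (if k = j then f ((L : ℤ), j) else 0) +
        (if k = j - 2 * L then (if 2 * L ≤ j then f (-(L : ℤ), j - 2 * L) else 0) else 0) := by
    intro k hk
    have hk' : k ≤ n := by simpa [Nat.lt_succ_iff] using hk
    rw [h.eq_zero_of_lt_abs (m := m + ((n - k : ℕ) : ℤ)) hp (lt_abs.2 (Or.inl (by omega))),
      add_zero, show m - ((n - k : ℕ) : ℤ) = L - j + k by omega]
    have hA : f ((L : ℤ), 0) = 0 := h.2.1 _ (by omega)
    have hB : f (-(L : ℤ), 0) = 0 := h.2.1 _ (by omega)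
    rcases Nat.eq_zero_or_pos k with rfl | hk0
    · have e₁ : (if 0 = j then f ((L : ℤ), j) else 0) = 0 := by
        split_ifs with c
        · rw [← c, hA]
        · rfl
      have e₂ : (if 0 = j - 2 * L then
          (if 2 * L ≤ j then f (-(L : ℤ), j - 2 * L) else 0) else 0) = 0 := by
        split_ifs with c
        · rw [← c, hB]
        all_goals rfl
      rw [e₁, e₂, if_pos rfl, add_zero, add_zero]
      split_ifs with c
      · rw [← h.1]
        congr 2
        omega
      · exact h.2.1 _ (by omega)
    · rw [if_neg hk0.ne', zero_add]
      by_cases c₁ : k = j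
      · rw [if_pos c₁, if_neg (by omega), add_zero, c₁]
        congr 2
        omega
      · rw [if_neg c₁, zero_add]
        by_cases c₂ : k = j - 2 * L
        · rw [if_pos c₂, if_pos (by omega), ← c₂]
          congr 2
          omega
        · rw [if_neg c₂]
          exact h.2.2 k hk0 _ (by omega) (by omega)
  unfold latticeY outgoingAmplitude
  rw [Finset.sum_congr rfl key, Finset.sum_add_distrib, Finset.sum_add_distrib,
    Finset.sum_ite_eq', Finset.sum_ite_eq', Finset.sum_ite_eq',
    if_pos (Finset.mem_range.2 (by omega)), if_pos (Finset.mem_range.2 (by omega)),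
    if_pos (Finset.mem_range.2 (by omega))]

theorem BoundaryForcing.latticeY_right_eq_zero_iff {L : ℕ} (hL : 1 ≤ L) {p : ℤ} {a : ℝ}
    {f : ℤ × ℕ → ℝ} (hp : |p| < (L : ℤ)) (h : BoundaryForcing L p a f) :
    (∀ m : ℤ, ∀ n : ℕ, (L : ℤ) < m → latticeY f m n = 0) ↔
      ∀ j, outgoingAmplitude L p a f j = 0 := by
  constructor
  · intro H j
    have := H (L + 1) (j + 1) (by omega)
    rw [h.latticeY_eq_outgoingAmplitude hL hp (j := j) (by omega) (by push_cast; ring)] at this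
    linarith
  · intro H m n hm
    by_cases c : (L : ℤ) + n < m
    · exact h.latticeY_eq_zero hp c
    · rw [h.latticeY_eq_outgoingAmplitude hL hp (j := (L + n - m).toNat) hm (by omega), H,
        mul_zero]

theorem BoundaryForcing.nonProp_iff {L : ℕ} (hL : 1 ≤ L) {p : ℤ} {a : ℝ}
    {f : ℤ × ℕ → ℝ} (hp : |p| < (L : ℤ)) (h : BoundaryForcing L p a f) :
    NonProp L f ↔ (∀ j, outgoingAmplitude L p a f j = 0) ∧
      ∀ j, outgoingAmplitude L (-p) a (reflectForcing f) j = 0 := by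
  rw [← h.latticeY_right_eq_zero_iff hL hp,
    ← h.reflect.latticeY_right_eq_zero_iff hL (by rwa [abs_neg])]
  simp only [latticeY_reflectForcing]
  constructor
  · exact fun H => ⟨fun m n hm => H m n (lt_abs.2 (Or.inl hm)),
      fun m n hm => H (-m) n (lt_abs.2 (Or.inr (by simpa using hm)))⟩
  · rintro ⟨H₁, H₂⟩ m n hm
    rcases lt_abs.1 hm with hm | hm
    · exact H₁ m n hm
    · simpa using H₂ (-m) n hm

theorem BoundaryForcing.apply_add_two_mul {L : ℕ} {p : ℤ} {a : ℝ} {f : ℤ × ℕ → ℝ}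
    (hp : |p| < (L : ℤ)) (H : ∀ j, outgoingAmplitude L p a f j = 0) (n : ℕ) :
    f ((L : ℤ), n + 2 * L) = -f (-(L : ℤ), n) := by
  have hpL := abs_lt.1 hp
  have := H (n + 2 * L)
  rw [outgoingAmplitude, if_neg (by push_cast; omega), if_pos (by omega),
    Nat.add_sub_cancel] at this
  linarith

/-- The boundary values at `L` of the trapping forcing with impulse at `q`; those at `-L` are
obtained from the impulse at `-q`. -/
noncomputable def trappingBoundary (L : ℕ) (a : ℝ) (q : ℤ) (j : ℕ) : ℝ :=
  if _h : L = 0 ∨ j < 2 * L then (if (j : ℤ) = L - q then -a else 0)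
  else -trappingBoundary L a (-q) (j - 2 * L)
termination_by j
decreasing_by omega

/-- The trapping forcing. -/
noncomputable def trappingForcing (L : ℕ) (p : ℤ) (a : ℝ) : ℤ × ℕ → ℝ := fun x =>
  if x.2 = 0 then (if x.1 = p then a else 0)
  else if x.1 = L then trappingBoundary L a p x.2
  else if x.1 = -L then trappingBoundary L a (-p) x.2
  else 0

theorem boundaryForcing_trappingForcing (L : ℕ) (p : ℤ) (a : ℝ) :
    BoundaryForcing L p a (trappingForcing L p a) := by
  refine ⟨by simp [trappingForcing], fun m hm => by simp [trappingForcing, hm],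
    fun n hn m hm hm' => ?_⟩
  simp [trappingForcing, hm, hm', Nat.one_le_iff_ne_zero.1 hn]

theorem trappingBoundary_zero {L : ℕ} (hL : 1 ≤ L) {q : ℤ} (hq : |q| < (L : ℤ)) (a : ℝ) :
    trappingBoundary L a q 0 = 0 := by
  have := abs_lt.1 hq
  rw [trappingBoundary, dif_pos (by omega), if_neg (by push_cast; omega)]

theorem trappingForcing_right {L : ℕ} (hL : 1 ≤ L) {p : ℤ} (hp : |p| < (L : ℤ)) (a : ℝ)
    (j : ℕ) : trappingForcing L p a ((L : ℤ), j) = trappingBoundary L a p j := by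
  have := abs_lt.1 hp
  rcases Nat.eq_zero_or_pos j with rfl | hj
  · simp [trappingForcing, trappingBoundary_zero hL hp, this.2.ne']
  · simp [trappingForcing, hj.ne']

theorem reflectForcing_trappingForcing {L : ℕ} (hL : 1 ≤ L) (p : ℤ) (a : ℝ) :
    reflectForcing (trappingForcing L p a) = trappingForcing L (-p) a := by
  ext ⟨m, n⟩
  simp only [reflectForcing, trappingForcing, neg_neg]
  split_ifs <;> first | rfl | omega

theorem outgoingAmplitude_trappingForcing {L : ℕ} (hL : 1 ≤ L) {p : ℤ} (hp : |p| < (L : ℤ))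
    (a : ℝ) (j : ℕ) : outgoingAmplitude L p a (trappingForcing L p a) j = 0 := by
  have hpL := abs_lt.1 hp
  have hleft (k : ℕ) : trappingForcing L p a (-(L : ℤ), k) = trappingBoundary L a (-p) k := by
    rw [← trappingForcing_right hL (by rwa [abs_neg]), ← reflectForcing_trappingForcing hL]
    rfl
  rw [outgoingAmplitude, trappingForcing_right hL hp, hleft, trappingBoundary]
  by_cases c : j < 2 * L
  · rw [dif_pos (Or.inr c), if_neg (by omega : ¬ 2 * L ≤ j)]
    split_ifs <;> simp
  · rw [dif_neg (by omega), if_pos (by omega : 2 * L ≤ j), if_neg (by omega)]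
    simp

theorem nonProp_trappingForcing {L : ℕ} (hL : 1 ≤ L) {p : ℤ} (hp : |p| < (L : ℤ)) (a : ℝ) :
    NonProp L (trappingForcing L p a) := by
  rw [(boundaryForcing_trappingForcing L p a).nonProp_iff hL hp,
    reflectForcing_trappingForcing hL]
  exact ⟨outgoingAmplitude_trappingForcing hL hp a,
    outgoingAmplitude_trappingForcing hL (by rwa [abs_neg]) a⟩

/-- Boundary values are determined by causality. -/
theorem BoundaryForcing.eq_of_nonProp {L : ℕ} (hL : 1 ≤ L) {p : ℤ} {a : ℝ} {f g : ℤ × ℕ → ℝ}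
    (hp : |p| < (L : ℤ)) (hf : BoundaryForcing L p a f) (hg : BoundaryForcing L p a g)
    (hfn : NonProp L f) (hgn : NonProp L g) : f = g := by
  obtain ⟨f₁, f₂⟩ := (hf.nonProp_iff hL hp).1 hfn
  obtain ⟨g₁, g₂⟩ := (hg.nonProp_iff hL hp).1 hgn
  have boundary : ∀ j, f ((L : ℤ), j) = g ((L : ℤ), j) ∧ f (-(L : ℤ), j) = g (-(L : ℤ), j) := by
    intro j
    induction j using Nat.strong_induction_on with
    | _ j ih =>
      have a₁ := (f₁ j).trans (g₁ j).symm
      have a₂ := (f₂ j).trans (g₂ j).symm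
      simp only [outgoingAmplitude, reflectForcing, neg_neg] at a₁ a₂
      by_cases c : 2 * L ≤ j
      · have := ih (j - 2 * L) (by omega)
        rw [this.2] at a₁
        rw [this.1] at a₂
        constructor <;> linarith
      · simp only [if_neg c] at a₁ a₂
        constructor <;> linarith
  ext ⟨m, n⟩
  by_cases hm : m = L
  · rw [hm, (boundary n).1]
  by_cases hm' : m = -L
  · rw [hm', (boundary n).2]
  rcases Nat.eq_zero_or_pos n with rfl | hn
  · by_cases hmp : m = p
    · rw [hmp, hf.1, hg.1]
    · rw [hf.2.1 m hmp, hg.2.1 m hmp]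
  · rw [hf.2.2 n hn m hm' hm, hg.2.2 n hn m hm' hm]

/-- among all forcings with a single interior impulse at `(p,0)` and
subsequent forces only at the boundaries `±L`, exactly one is non-propagating;
it satisfies `f(∓L, n+2L) = -f(±L, n)` and hence is `4L`-periodic in time. -/
theorem unique_trapping_forcing_and_periodicity
    (L : ℕ) (hL : 1 ≤ L) (p : ℤ) (hp : |p| < (L : ℤ)) (a : ℝ) (ha : a ≠ 0) :
    (∃! f : ℤ × ℕ → ℝ,
      (f (p, 0) = a ∧
       (∀ m : ℤ, m ≠ p → f (m, 0) = 0) ∧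
       (∀ n : ℕ, 1 ≤ n → ∀ m : ℤ, m ≠ -(L : ℤ) → m ≠ (L : ℤ) → f (m, n) = 0)) ∧
      NonProp L f) ∧
    (∀ f : ℤ × ℕ → ℝ,
      (f (p, 0) = a ∧
       (∀ m : ℤ, m ≠ p → f (m, 0) = 0) ∧
       (∀ n : ℕ, 1 ≤ n → ∀ m : ℤ, m ≠ -(L : ℤ) → m ≠ (L : ℤ) → f (m, n) = 0)) →
      NonProp L f →
      ((∀ n : ℕ, 1 ≤ n →
          f (-(L : ℤ), n + 2 * L) = -f ((L : ℤ), n) ∧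
          f ((L : ℤ), n + 2 * L) = -f (-(L : ℤ), n)) ∧
       (∀ n : ℕ, 1 ≤ n →
          f (-(L : ℤ), n + 4 * L) = f (-(L : ℤ), n) ∧
          f ((L : ℤ), n + 4 * L) = f ((L : ℤ), n)))) := by
  refine ⟨⟨trappingForcing L p a, ⟨boundaryForcing_trappingForcing L p a,
    nonProp_trappingForcing hL hp a⟩, fun g hg => ?_⟩, fun f hf hfn => ?_⟩
  · exact BoundaryForcing.eq_of_nonProp hL hp hg.1 (boundaryForcing_trappingForcing L p a) hg.2
      (nonProp_trappingForcing hL hp a)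
  · obtain ⟨h₁, h₂⟩ := (BoundaryForcing.nonProp_iff hL hp hf).1 hfn
    have right := BoundaryForcing.apply_add_two_mul hp h₁
    have left (n : ℕ) : f (-(L : ℤ), n + 2 * L) = -f ((L : ℤ), n) := by
      simpa [reflectForcing] using
        BoundaryForcing.apply_add_two_mul (by rwa [abs_neg]) h₂ n
    refine ⟨fun n _ => ⟨left n, right n⟩, fun n _ => ?_⟩
    rw [show n + 4 * L = n + 2 * L + 2 * L by ring]
    exact ⟨by rw [left, right, neg_neg], by rw [right, left, neg_neg]⟩
end

section
/- Let L be a positive integer and let f : ℤ × ℕ → ℝ satisfy f(m,n) = 0 for all n ∈ ℕ whenever m ∉ {−L, L} (boundary-only point sources, zero initial field). If f is non-propagating, then f is identically zero. Consequently, any nonzero pair of point sources switched on at the boundaries of the region must radiate waves outside the region at some time (onset transient radiation is unavoidable). -/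
/-- If the forcing vanishes before time `n`, the displacement at time `n + 1` only sees the forcing
at times `n` and `n + 1`. -/
theorem latticeY_succ_of_forall_lt {f : ℤ × ℕ → ℝ} {n : ℕ}
    (hf : ∀ k < n, ∀ m : ℤ, f (m, k) = 0) (m : ℤ) :
    latticeY f m (n + 1) = (1 / 2) * (f (m - 1, n) + f (m + 1, n)) + f (m, n + 1) := by
  have h : ∑ k ∈ Finset.range n,
      (f (m - ((n + 1 - k : ℕ) : ℤ), k) + f (m + ((n + 1 - k : ℕ) : ℤ), k)) = 0 :=
    Finset.sum_eq_zero fun k hk => by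
      rw [hf k (Finset.mem_range.1 hk), hf k (Finset.mem_range.1 hk), add_zero]
  rw [latticeY, Finset.sum_range_succ, Finset.sum_range_succ, h]
  simp only [Nat.add_sub_cancel_left, Nat.sub_self, Nat.cast_one, Nat.cast_zero, sub_zero, add_zero]
  ring

/-- a boundary-only pair of point sources with zero initial field
that is non-propagating must be identically zero: onset transient radiation of
nonzero boundary sources is unavoidable. -/
theorem boundary_only_nonprop_is_zero
    (L : ℕ) (hL : 1 ≤ L) (f : ℤ × ℕ → ℝ)
    (hbd : ∀ m : ℤ, ∀ n : ℕ, m ≠ -(L : ℤ) → m ≠ (L : ℤ) → f (m, n) = 0)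
    (hnp : NonProp L f) :
    ∀ m : ℤ, ∀ n : ℕ, f (m, n) = 0 := by
  intro m n
  induction n using Nat.strong_induction_on generalizing m with
  | _ n ih =>
    by_cases hr : m = L
    · have h := hnp (L + 1) (n + 1) (by rw [abs_of_nonneg] <;> omega)
      rw [latticeY_succ_of_forall_lt fun k hk m => ih k hk m,
        hbd (L + 1 + 1) n (by omega) (by omega), hbd (L + 1) (n + 1) (by omega) (by omega),
        add_sub_cancel_right] at h
      rw [hr]
      linarith
    by_cases hl : m = -L
    · have h := hnp (-L - 1) (n + 1) (by rw [abs_of_nonpos] <;> omega)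
      rw [latticeY_succ_of_forall_lt fun k hk m => ih k hk m,
        hbd (-L - 1 - 1) n (by omega) (by omega), hbd (-L - 1) (n + 1) (by omega) (by omega),
        sub_add_cancel] at h
      rw [hl]
      linarith
    exact hbd m n hl hr
end

section
/- Let L be a positive integer and let f : ℤ × ℕ → ℝ satisfy f(m,n) = 0 whenever m ∉ {−L, L} (boundary-only point sources, zero initial field). Suppose the sources satisfy the phase-matching conditions f(−L,n) = −f(L, n−2L) and f(L,n) = −f(−L, n−2L) for all n ≥ 2L. Then for every m < −L and every n ∈ ℕ: y_f(m,n) = (1/2)·f(−L, m+n+L) if 0 ≤ m+n+L < 2L, and y_f(m,n) = 0 otherwise. That is, only the waves emitted during the first trap period of 2L time-steps escape the region, and they escape with half amplitude. -/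
/-- for phase-matched boundary point sources, only the waves emitted
during the first trap period of `2L` time-steps escape the region to the left,
and they escape with half amplitude. -/
theorem phase_matched_sources_first_period_escape
    (L : ℕ) (hL : 1 ≤ L) (f : ℤ × ℕ → ℝ)
    (hbd : ∀ m : ℤ, ∀ n : ℕ, m ≠ -(L : ℤ) → m ≠ (L : ℤ) → f (m, n) = 0)
    (hmatchL : ∀ n : ℕ, 2 * L ≤ n → f (-(L : ℤ), n) = -f ((L : ℤ), n - 2 * L))
    (hmatchR : ∀ n : ℕ, 2 * L ≤ n → f ((L : ℤ), n) = -f (-(L : ℤ), n - 2 * L)) :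
    ∀ m : ℤ, m < -(L : ℤ) → ∀ n : ℕ,
      latticeY f m n =
        if 0 ≤ m + (n : ℤ) + L ∧ m + (n : ℤ) + L < 2 * (L : ℤ) then
          (1 / 2) * f (-(L : ℤ), (m + (n : ℤ) + L).toNat)
        else 0 := by
  intro m hm n
  have hsummand : ∀ k ∈ Finset.range (n + 1),
      f (m - ((n - k : ℕ) : ℤ), k) + f (m + ((n - k : ℕ) : ℤ), k) =
        (if (k : ℤ) = m + n + L then f (-(L : ℤ), k) else 0) +
          (if (k : ℤ) = m + n - L then f ((L : ℤ), k) else 0) := by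
    intro k hk
    rw [Finset.mem_range] at hk
    rw [hbd (m - ((n - k : ℕ) : ℤ)) k (by omega) (by omega), zero_add]
    by_cases h₁ : (k : ℤ) = m + n + L
    · rw [if_pos h₁, if_neg (by omega), add_zero,
        show m + ((n - k : ℕ) : ℤ) = -(L : ℤ) by omega]
    · by_cases h₂ : (k : ℤ) = m + n - L
      · rw [if_neg h₁, if_pos h₂, zero_add,
          show m + ((n - k : ℕ) : ℤ) = (L : ℤ) by omega]
      · rw [if_neg h₁, if_neg h₂, add_zero]
        exact hbd _ _ (by omega) (by omega)
  have hsum : ∀ (g : ℕ → ℝ) (a : ℤ), a ≤ n →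
      ∑ k ∈ Finset.range (n + 1), (if (k : ℤ) = a then g k else 0) =
        if 0 ≤ a then g a.toNat else 0 := by
    intro g a ha
    split_ifs with h
    · lift a to ℕ using h
      have ha' : a < n + 1 := by omega
      simp [ha']
    · exact Finset.sum_eq_zero fun k _ => if_neg (by omega)
  rw [latticeY, Finset.sum_congr rfl hsummand, Finset.sum_add_distrib,
    hsum (fun k => f (-(L : ℤ), k)) _ (by omega), hsum (fun k => f ((L : ℤ), k)) _ (by omega)]
  by_cases h₁ : 0 ≤ m + n - L
  · rw [if_pos (by omega), if_pos h₁, if_neg (by omega), hmatchL _ (by omega),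
      show (m + n + L).toNat - 2 * L = (m + n - L).toNat by omega]
    ring
  · by_cases h₂ : 0 ≤ m + n + L
    · rw [if_pos h₂, if_neg h₁, if_pos (by omega), add_zero]
    · rw [if_neg h₂, if_neg h₁, if_neg (by omega), add_zero, mul_zero]
end

section
/- Let L be a positive integer and let f : ℤ × ℕ → ℝ satisfy: f(m,n) = 0 for all |m| > L; f(m,n) = 0 for every n ≥ 1 and m ∉ {−L, L} (interior forcing only at time 0); and f is non-propagating. Then the trapped field satisfies the mirror anti-symmetry y_f(m, n+2L) = −y_f(−m, n) for all m ∈ ℤ and n ∈ ℕ, and consequently it is periodic in time with period 4L: y_f(m, n+4L) = y_f(m, n) for all m ∈ ℤ and n ∈ ℕ. -/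
/-- The total of the right-traveling components of `f` that have reached site `m` by time `n`. -/
noncomputable def rightField (f : ℤ × ℕ → ℝ) (m : ℤ) (n : ℕ) : ℝ :=
  ∑ k ∈ Finset.range (n + 1), f (m - ((n - k : ℕ) : ℤ), k)

/-- The mirror image of a forcing function. -/
def mirror (f : ℤ × ℕ → ℝ) : ℤ × ℕ → ℝ := fun p => f (-p.1, p.2)

lemma latticeY_eq_rightField (f : ℤ × ℕ → ℝ) (m : ℤ) (n : ℕ) :
    latticeY f m n = (1 / 2) * (rightField f m n + rightField (mirror f) (-m) n) := by
  simp only [latticeY, rightField, mirror, Finset.sum_add_distrib]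
  congr 3
  ext k
  congr 2
  ring

lemma mirror_mirror (f : ℤ × ℕ → ℝ) : mirror (mirror f) = f := by
  ext p
  simp [mirror]

lemma latticeY_mirror (f : ℤ × ℕ → ℝ) (m : ℤ) (n : ℕ) :
    latticeY (mirror f) m n = latticeY f (-m) n := by
  rw [latticeY_eq_rightField, latticeY_eq_rightField, mirror_mirror, neg_neg, add_comm]

lemma NonProp.mirror {L : ℕ} {f : ℤ × ℕ → ℝ} (h : NonProp L f) : NonProp L (mirror f) := by
  intro m n hm
  rw [latticeY_mirror]
  exact h _ _ (by rwa [abs_neg])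

lemma rightField_succ (f : ℤ × ℕ → ℝ) (m : ℤ) (n : ℕ) :
    rightField f (m + 1) (n + 1) = rightField f m n + f (m + 1, n + 1) := by
  unfold rightField
  rw [Finset.sum_range_succ]
  congr 1
  · refine Finset.sum_congr rfl fun k hk => ?_
    have : k ≤ n := by simpa [Nat.lt_succ_iff] using hk
    congr 2
    omega
  · simp

section Trapped

variable {L : ℕ} {f : ℤ × ℕ → ℝ}

lemma rightField_left_eq_zero (hsupp : ∀ m : ℤ, ∀ n : ℕ, (L : ℤ) < |m| → f (m, n) = 0)
    {m : ℤ} (hm : m < -(L : ℤ)) (n : ℕ) : rightField f m n = 0 := by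
  refine Finset.sum_eq_zero fun k _ => hsupp _ _ ?_
  rw [lt_abs]
  omega

lemma mirror_support (hsupp : ∀ m : ℤ, ∀ n : ℕ, (L : ℤ) < |m| → f (m, n) = 0) :
    ∀ m : ℤ, ∀ n : ℕ, (L : ℤ) < |m| → mirror f (m, n) = 0 :=
  fun m n hm => hsupp (-m) n (by rwa [abs_neg])

lemma mirror_boundary
    (hbd : ∀ n : ℕ, 1 ≤ n → ∀ m : ℤ, m ≠ -(L : ℤ) → m ≠ (L : ℤ) → f (m, n) = 0) :
    ∀ n : ℕ, 1 ≤ n → ∀ m : ℤ, m ≠ -(L : ℤ) → m ≠ (L : ℤ) → mirror f (m, n) = 0 :=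
  fun n hn m h₁ h₂ => hbd n hn (-m) (by omega) (by omega)

lemma rightField_right_eq_zero (hsupp : ∀ m : ℤ, ∀ n : ℕ, (L : ℤ) < |m| → f (m, n) = 0)
    (hnp : NonProp L f) {m : ℤ} (hm : (L : ℤ) < m) (n : ℕ) : rightField f m n = 0 := by
  have h := hnp m n (lt_abs.2 (Or.inl hm))
  rw [latticeY_eq_rightField, rightField_left_eq_zero (mirror_support hsupp) (by omega)] at h
  linarith

lemma rightField_boundary (hsupp : ∀ m : ℤ, ∀ n : ℕ, (L : ℤ) < |m| → f (m, n) = 0)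
    (hnp : NonProp L f) (n : ℕ) : rightField f L n = 0 := by
  have h := rightField_succ f L n
  rw [rightField_right_eq_zero hsupp hnp (by omega),
    hsupp _ _ (lt_abs.2 (Or.inl (by omega)))] at h
  linarith

/-- The right-traveling field inside the trap is cancelled when it reaches the right end. -/
lemma rightField_interior (hsupp : ∀ m : ℤ, ∀ n : ℕ, (L : ℤ) < |m| → f (m, n) = 0)
    (hbd : ∀ n : ℕ, 1 ≤ n → ∀ m : ℤ, m ≠ -(L : ℤ) → m ≠ (L : ℤ) → f (m, n) = 0)
    (hnp : NonProp L f) (d : ℕ) (hd : d + 1 ≤ 2 * L) (n : ℕ) :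
    rightField f (L - (d + 1 : ℤ)) n = -f (L, n + (d + 1)) := by
  induction d generalizing n with
  | zero =>
    have h := rightField_succ f (L - 1) n
    rw [sub_add_cancel, rightField_boundary hsupp hnp] at h
    simp only [Nat.cast_zero, zero_add]
    linarith
  | succ d ih =>
    have h := rightField_succ f (L - (d + 1 + 1 : ℤ)) n
    rw [show (L - (d + 1 + 1 : ℤ) + 1 : ℤ) = L - (d + 1 : ℤ) by ring, ih (by omega),
      hbd (n + 1) (by omega) (L - (d + 1 : ℤ)) (by omega) (by omega), add_zero] at h
    push_cast
    rw [← h, show n + 1 + (d + 1) = n + (d + 1 + 1) by ring]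

/-- The force at the right end is the negative of the force at the left end `2L` earlier. -/
lemma force_right_eq_neg_force_left (hL : 1 ≤ L)
    (hsupp : ∀ m : ℤ, ∀ n : ℕ, (L : ℤ) < |m| → f (m, n) = 0)
    (hbd : ∀ n : ℕ, 1 ≤ n → ∀ m : ℤ, m ≠ -(L : ℤ) → m ≠ (L : ℤ) → f (m, n) = 0)
    (hnp : NonProp L f) (n : ℕ) : f (L, n + 2 * L) = -f (-L, n) := by
  have h := rightField_interior hsupp hbd hnp (2 * L - 1) (by omega) n
  rw [show (L - ((2 * L - 1 : ℕ) + 1 : ℤ) : ℤ) = -L by omega,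
    show n + (2 * L - 1 + 1) = n + 2 * L by omega] at h
  have h' : rightField f (-L) n = f (-L, n) := by
    cases n with
    | zero => simp [rightField]
    | succ n =>
      have h₁ := rightField_succ f (-L - 1) n
      rwa [sub_add_cancel, rightField_left_eq_zero hsupp (m := -L - 1) (by omega), zero_add] at h₁
  linarith

/-- The right-traveling field at time `n + 2L` is the negative of the left-traveling field at the
mirror site at time `n`. -/
lemma rightField_add_two_mul (hL : 1 ≤ L)
    (hsupp : ∀ m : ℤ, ∀ n : ℕ, (L : ℤ) < |m| → f (m, n) = 0)
    (hbd : ∀ n : ℕ, 1 ≤ n → ∀ m : ℤ, m ≠ -(L : ℤ) → m ≠ (L : ℤ) → f (m, n) = 0)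
    (hnp : NonProp L f) {m : ℤ} (hm : |m| ≤ L) (n : ℕ) :
    rightField f m (n + 2 * L) = -rightField (mirror f) m n := by
  obtain ⟨h₁, h₂⟩ := abs_le.1 hm
  rcases h₂.eq_or_lt with rfl | h₂
  · rw [rightField_boundary hsupp hnp, rightField_boundary (mirror_support hsupp) hnp.mirror,
      neg_zero]
  · obtain ⟨d, hd⟩ : ∃ d : ℕ, m = L - (d + 1 : ℤ) := ⟨(L - m - 1).toNat, by omega⟩
    subst hd
    rw [rightField_interior hsupp hbd hnp d (by omega),
      rightField_interior (mirror_support hsupp) (mirror_boundary hbd) hnp.mirror d (by omega),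
      show n + 2 * L + (d + 1) = n + (d + 1) + 2 * L by ring,
      force_right_eq_neg_force_left hL hsupp hbd hnp]
    rfl

end Trapped

/-- a trapped field from an interior forcing at time 0 and boundary
forces satisfies the mirror anti-symmetry `y(m, n+2L) = -y(-m, n)` and is
`4L`-periodic in time. -/
theorem trapped_field_mirror_antisymmetry_and_periodicity
    (L : ℕ) (hL : 1 ≤ L) (f : ℤ × ℕ → ℝ)
    (hsupp : ∀ m : ℤ, ∀ n : ℕ, (L : ℤ) < |m| → f (m, n) = 0)
    (hbd : ∀ n : ℕ, 1 ≤ n → ∀ m : ℤ, m ≠ -(L : ℤ) → m ≠ (L : ℤ) → f (m, n) = 0)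
    (hnp : NonProp L f) :
    (∀ m : ℤ, ∀ n : ℕ, latticeY f m (n + 2 * L) = -latticeY f (-m) n) ∧
    (∀ m : ℤ, ∀ n : ℕ, latticeY f m (n + 4 * L) = latticeY f m n) := by
  have anti : ∀ m : ℤ, ∀ n : ℕ, latticeY f m (n + 2 * L) = -latticeY f (-m) n := by
    intro m n
    rcases lt_or_ge (L : ℤ) |m| with hm | hm
    · rw [hnp _ _ hm, hnp _ _ (by rwa [abs_neg]), neg_zero]
    · rw [latticeY_eq_rightField, latticeY_eq_rightField, neg_neg,
        rightField_add_two_mul hL hsupp hbd hnp hm,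
        rightField_add_two_mul hL (mirror_support hsupp) (mirror_boundary hbd) hnp.mirror
          (by rwa [abs_neg]), mirror_mirror]
      ring
  refine ⟨anti, fun m n => ?_⟩
  rw [show n + 4 * L = n + 2 * L + 2 * L by ring, anti, anti, neg_neg, neg_neg]
end

section
/- Let L ≥ 1 and p be integers with |p| < L, let a ≠ 0 be real, and let f : ℤ × ℕ → ℝ be a non-propagating forcing with f(p,0) = a, f(m,0) = 0 for m ≠ p, and f(m,n) = 0 for every n ≥ 1 and m ∉ {−L, L}. Then for every integer μ ≥ 1, the two traveling half-pulses coincide at time 2μL: y_f(m, 2μL) = (−1)^μ·a if m = (−1)^μ·p and y_f(m, 2μL) = 0 for all other m. In particular the trapped impulse occupies a single site with inverted sign at every odd multiple of 2L and returns to its initial position and sign at every multiple of 4L. -/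
/-- The history of `f` at the site `c`, extended by zero to negative times. -/
noncomputable def siteHistory (f : ℤ × ℕ → ℝ) (c t : ℤ) : ℝ :=
  if 0 ≤ t then f (c, t.toNat) else 0

lemma siteHistory_of_neg (f : ℤ × ℕ → ℝ) (c : ℤ) {t : ℤ} (ht : t < 0) :
    siteHistory f c t = 0 := if_neg (by omega)

lemma siteHistory_natCast (f : ℤ × ℕ → ℝ) (c : ℤ) (k : ℕ) :
    siteHistory f c k = f (c, k) := by
  simp [siteHistory]

/-- Along a right-going characteristic, only one time contributes for each fixed site. -/
lemma sum_site_eq_siteHistory (f : ℤ × ℕ → ℝ) (c s : ℤ) (n : ℕ) :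
    ∑ k ∈ Finset.range (n + 1), (if s + (k : ℤ) = c then f (c, k) else 0) =
      if c - s ≤ n then siteHistory f c (c - s) else 0 := by
  by_cases h0 : 0 ≤ c - s
  · obtain ⟨j, hj⟩ := Int.eq_ofNat_of_zero_le h0
    have h (k : ℕ) : s + (k : ℤ) = c ↔ k = j := by omega
    rw [hj, siteHistory_natCast]
    simp only [h, Finset.sum_ite_eq', Finset.mem_range, Nat.lt_succ_iff, Nat.cast_le]
  · rw [siteHistory_of_neg f c (by omega), ite_self]
    exact Finset.sum_eq_zero fun k _ => if_neg (by omega)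

/-- The forcing is an initial impulse of size `a` at the interior site `p`, followed by
forcing at the two sites `±L` only. -/
structure IsBoundaryForced (L : ℕ) (p : ℤ) (a : ℝ) (f : ℤ × ℕ → ℝ) : Prop where
  position_lt : |p| < (L : ℤ)
  impulse : f (p, 0) = a
  zero_of_ne : ∀ m : ℤ, m ≠ p → f (m, 0) = 0
  interior : ∀ n : ℕ, 1 ≤ n → ∀ m : ℤ, m ≠ -(L : ℤ) → m ≠ (L : ℤ) → f (m, n) = 0

/-- Spatial reflection of a forcing. -/
def reflect (f : ℤ × ℕ → ℝ) : ℤ × ℕ → ℝ := fun x => f (-x.1, x.2)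

lemma siteHistory_reflect (f : ℤ × ℕ → ℝ) (c t : ℤ) :
    siteHistory (reflect f) c t = siteHistory f (-c) t := rfl

lemma latticeY_reflect (f : ℤ × ℕ → ℝ) (m : ℤ) (n : ℕ) :
    latticeY (reflect f) m n = latticeY f (-m) n := by
  unfold latticeY reflect
  congr 1
  refine Finset.sum_congr rfl fun k _ => ?_
  rw [add_comm]
  congr 3 <;> ring

lemma NonProp.reflect {L : ℕ} {f : ℤ × ℕ → ℝ} (h : NonProp L f) : NonProp L (reflect f) := by
  intro m n hm
  rw [latticeY_reflect]
  exact h _ _ (by rwa [abs_neg])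

/-- The displacement is the mean of two sums along characteristics. -/
lemma latticeY_eq_characteristic_sums (f : ℤ × ℕ → ℝ) (m : ℤ) (n : ℕ) :
    latticeY f m n = (1 / 2) * (∑ k ∈ Finset.range (n + 1), f (m - n + k, k) +
      ∑ k ∈ Finset.range (n + 1), reflect f (-m - n + k, k)) := by
  unfold latticeY reflect
  rw [← Finset.sum_add_distrib]
  congr 1
  refine Finset.sum_congr rfl fun k hk => ?_
  rw [Nat.cast_sub (Finset.mem_range_succ_iff.mp hk)]
  congr 3 <;> ring

namespace IsBoundaryForced

variable {L : ℕ} {p : ℤ} {a : ℝ} {f : ℤ × ℕ → ℝ}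

protected lemma reflect (h : IsBoundaryForced L p a f) :
    IsBoundaryForced L (-p) a (reflect f) where
  position_lt := by rw [abs_neg]; exact h.position_lt
  impulse := by simp [_root_.reflect, h.impulse]
  zero_of_ne m hm := h.zero_of_ne _ (by omega)
  interior n hn m h1 h2 := h.interior n hn _ (by omega) (by omega)

lemma siteHistory_of_nonpos (h : IsBoundaryForced L p a f) {t : ℤ} (ht : t ≤ 0) :
    siteHistory f L t = 0 := by
  rcases ht.lt_or_eq with ht | rfl
  · exact siteHistory_of_neg f L ht
  · have := abs_lt.mp h.position_lt
    exact h.zero_of_ne _ (by omega)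

lemma apply_eq (h : IsBoundaryForced L p a f) (m : ℤ) (k : ℕ) :
    f (m, k) = (if m - k = p then if k = 0 then a else 0 else 0) +
      (if m = -(L : ℤ) then f (-(L : ℤ), k) else 0) +
      (if m = (L : ℤ) then f ((L : ℤ), k) else 0) := by
  have hp := abs_lt.mp h.position_lt
  rcases Nat.eq_zero_or_pos k with rfl | hk
  · rw [h.zero_of_ne (-L) (by omega), h.zero_of_ne L (by omega)]
    by_cases hm : m = p
    · simp [hm, h.impulse]
    · simp [hm, h.zero_of_ne m hm]
  · rw [if_neg hk.ne', ite_self, zero_add]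
    by_cases h1 : m = -(L : ℤ)
    · rw [if_pos h1, if_neg (by omega), h1, add_zero]
    · by_cases h2 : m = (L : ℤ)
      · rw [if_neg h1, if_pos h2, h2, zero_add]
      · rw [if_neg h1, if_neg h2, h.interior k hk m h1 h2, add_zero]

lemma characteristic_sum (h : IsBoundaryForced L p a f) (s : ℤ) (n : ℕ) :
    ∑ k ∈ Finset.range (n + 1), f (s + k, k) = (if s = p then a else 0) +
      (if -L - s ≤ n then siteHistory f (-L) (-L - s) else 0) +
      (if L - s ≤ n then siteHistory f L (L - s) else 0) := by
  rw [← sum_site_eq_siteHistory, ← sum_site_eq_siteHistory]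
  have hs : (if s = p then a else 0) = ∑ k ∈ Finset.range (n + 1),
      (if s + (k : ℤ) - k = p then if k = 0 then a else 0 else 0) := by
    by_cases hsp : s = p <;> simp [hsp]
  rw [hs, ← Finset.sum_add_distrib, ← Finset.sum_add_distrib]
  exact Finset.sum_congr rfl fun k _ => h.apply_eq _ k

/-- The forcing at the right end absorbs whatever arrives there. -/
lemma siteHistory_right (h : IsBoundaryForced L p a f) (hnp : NonProp L f) (t : ℤ) :
    siteHistory f L t =
      -(if t = L - p then a else 0) - siteHistory f (-L) (t - 2 * L) := by
  have hp := abs_lt.mp h.position_lt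
  rcases lt_or_ge t 0 with ht | ht
  · rw [siteHistory_of_neg _ _ ht, siteHistory_of_neg _ _ (by omega), if_neg (by omega)]
    simp
  · obtain ⟨j, rfl⟩ := Int.eq_ofNat_of_zero_le ht
    have hz := hnp (L + 1) (j + 1) (by rw [abs_of_nonneg] <;> omega)
    rw [latticeY_eq_characteristic_sums, h.characteristic_sum, h.reflect.characteristic_sum,
      if_pos (by push_cast; omega : -(L : ℤ) - (L + 1 - (j + 1 : ℕ)) ≤ (j + 1 : ℕ)),
      if_pos (by push_cast; omega : (L : ℤ) - (L + 1 - (j + 1 : ℕ)) ≤ (j + 1 : ℕ)),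
      if_neg (by push_cast; omega : ¬ (-((L : ℤ) + 1) - (j + 1 : ℕ) = -p)),
      if_neg (by push_cast; omega : ¬ -(L : ℤ) - (-(L + 1) - (j + 1 : ℕ)) ≤ (j + 1 : ℕ)),
      if_neg (by push_cast; omega : ¬ (L : ℤ) - (-(L + 1) - (j + 1 : ℕ)) ≤ (j + 1 : ℕ))] at hz
    have e1 : (-(L : ℤ) - ((L : ℤ) + 1 - (j + 1 : ℕ))) = j - 2 * L := by push_cast; ring
    have e2 : ((L : ℤ) - ((L : ℤ) + 1 - (j + 1 : ℕ))) = j := by push_cast; ring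
    have e3 : ((L : ℤ) + 1 - (j + 1 : ℕ) = p) ↔ ((j : ℤ) = L - p) := by push_cast; omega
    rw [e1, e2] at hz
    simp only [e3] at hz
    linarith

/-- The forcing at the right end during the period around time `(2μ+1)L`. -/
lemma siteHistory_right_period (μ : ℕ) : ∀ {p : ℤ} {f : ℤ × ℕ → ℝ},
    IsBoundaryForced L p a f → NonProp L f → ∀ m : ℤ, |m| ≤ L →
      siteHistory f L ((2 * μ + 1) * L + m) =
        if m = (-1 : ℤ) ^ (μ + 1) * p then (-1 : ℝ) ^ (μ + 1) * a else 0 := by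
  induction μ with
  | zero =>
    intro p f h hnp m hm
    have hm' := abs_le.mp hm
    have hz := h.reflect.siteHistory_of_nonpos
      (t := (2 * (0 : ℕ) + 1) * (L : ℤ) + m - 2 * L) (by push_cast; linarith)
    rw [siteHistory_reflect] at hz
    rw [h.siteHistory_right hnp, hz]
    have e : (2 * ((0 : ℕ) : ℤ) + 1) * (L : ℤ) + m = L - p ↔ m = (-1 : ℤ) ^ (0 + 1) * p := by
      push_cast; constructor <;> intro <;> linarith
    simp only [e]
    split_ifs <;> simp
  | succ μ ih =>
    intro p f h hnp m hm
    have hm' := abs_le.mp hm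
    have hp := abs_lt.mp h.position_lt
    have hih := ih h.reflect hnp.reflect m hm
    rw [siteHistory_reflect] at hih
    have e : (2 * ((μ + 1 : ℕ) : ℤ) + 1) * (L : ℤ) + m - 2 * L = (2 * μ + 1) * L + m := by
      push_cast; ring
    have hne : ¬ (2 * ((μ + 1 : ℕ) : ℤ) + 1) * (L : ℤ) + m = L - p := by
      have : (0 : ℤ) ≤ μ * L := by positivity
      push_cast
      intro hc
      linarith
    have e2 : (-1 : ℤ) ^ (μ + 1 + 1) * p = (-1 : ℤ) ^ (μ + 1) * -p := by ring
    rw [h.siteHistory_right hnp, if_neg hne, e, hih, e2]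
    split_ifs <;> ring

end IsBoundaryForced

/-- the two trapped traveling half-pulses coincide at every time
`2μL`, occupying the single site `(-1)^μ·p` with value `(-1)^μ·a`. -/
theorem trapped_impulse_recurrence
    (L : ℕ) (hL : 1 ≤ L) (p : ℤ) (hp : |p| < (L : ℤ)) (a : ℝ) (ha : a ≠ 0)
    (f : ℤ × ℕ → ℝ)
    (hf0 : f (p, 0) = a)
    (hf0' : ∀ m : ℤ, m ≠ p → f (m, 0) = 0)
    (hbd : ∀ n : ℕ, 1 ≤ n → ∀ m : ℤ, m ≠ -(L : ℤ) → m ≠ (L : ℤ) → f (m, n) = 0)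
    (hnp : NonProp L f) :
    ∀ μ : ℕ, 1 ≤ μ → ∀ m : ℤ,
      latticeY f m (2 * μ * L) =
        if m = (-1 : ℤ) ^ μ * p then (-1 : ℝ) ^ μ * a else 0 := by
  intro μ hμ m
  have h : IsBoundaryForced L p a f := ⟨hp, hf0, hf0', hbd⟩
  have hp' := abs_lt.mp hp
  obtain ⟨ν, rfl⟩ := Nat.exists_eq_add_of_le' hμ
  have hsign : (-1 : ℤ) ^ (ν + 1) * p = p ∨ (-1 : ℤ) ^ (ν + 1) * p = -p := by
    rcases neg_one_pow_eq_or ℤ (ν + 1) with h | h <;> simp [h]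
  rcases lt_or_ge (L : ℤ) |m| with hm | hm
  · rw [hnp m _ hm, if_neg]
    rintro rfl
    simp only [abs_mul, abs_pow, abs_neg, abs_one, one_pow, one_mul] at hm
    exact hm.not_gt hp
  have hm' := abs_le.mp hm
  have hpos : (0 : ℤ) ≤ ν * L := by positivity
  have hn : ((2 * (ν + 1) * L : ℕ) : ℤ) = 2 * (ν * L) + 2 * L := by push_cast; ring
  have hR := IsBoundaryForced.siteHistory_right_period ν h hnp
  have hL' := IsBoundaryForced.siteHistory_right_period ν h.reflect hnp.reflect
  simp only [siteHistory_reflect] at hL'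
  have hRm := hR m hm
  have hLm := hL' (-m) (by rwa [abs_neg])
  have hRL := hR L (by simp)
  have hLL := hL' L (by simp)
  rw [if_neg (by rcases hsign with hs | hs <;> rw [hs] <;> omega)] at hRL
  rw [if_neg (by rcases hsign with hs | hs <;> rw [mul_neg, hs] <;> omega)] at hLL
  have e : -m = (-1 : ℤ) ^ (ν + 1) * -p ↔ m = (-1 : ℤ) ^ (ν + 1) * p := by
    rw [mul_neg, neg_inj]
  simp only [e] at hLm
  have t1 : (2 * (ν : ℤ) + 1) * L + -m = -L - (m - (2 * (ν + 1) * L : ℕ)) := by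
    rw [hn]; ring
  have t2 : (2 * (ν : ℤ) + 1) * L + m = -L - (-m - (2 * (ν + 1) * L : ℕ)) := by
    rw [hn]; ring
  rw [t1] at hLm
  rw [t2] at hRm
  have right_end : (if (L : ℤ) - (m - (2 * (ν + 1) * L : ℕ)) ≤ (2 * (ν + 1) * L : ℕ) then
      siteHistory f L (L - (m - (2 * (ν + 1) * L : ℕ))) else 0) = 0 := by
    split_ifs with hc
    · rw [← hRL]; congr 1; rw [hn] at *; linarith
    · rfl
  have left_end : (if (L : ℤ) - (-m - (2 * (ν + 1) * L : ℕ)) ≤ (2 * (ν + 1) * L : ℕ) then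
      siteHistory f (-L) (L - (-m - (2 * (ν + 1) * L : ℕ))) else 0) = 0 := by
    split_ifs with hc
    · rw [← hLL]; congr 1; rw [hn] at *; linarith
    · rfl
  rw [latticeY_eq_characteristic_sums, h.characteristic_sum, h.reflect.characteristic_sum]
  simp only [siteHistory_reflect, neg_neg]
  rw [right_end, left_end, hLm, hRm,
    if_neg (by omega : ¬ m - (2 * (ν + 1) * L : ℕ) = p),
    if_neg (by omega : ¬ -m - (2 * (ν + 1) * L : ℕ) = -p),
    if_pos (by omega : -(L : ℤ) - (m - (2 * (ν + 1) * L : ℕ)) ≤ (2 * (ν + 1) * L : ℕ)),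
    if_pos (by omega : -(L : ℤ) - (-m - (2 * (ν + 1) * L : ℕ)) ≤ (2 * (ν + 1) * L : ℕ))]
  ring
end

section
/- Let L ≥ 1, p, q, N be integers with |p| < L, |q| < L, N ≥ 1, let a, b be nonzero reals, and let f : ℤ × ℕ → ℝ satisfy: f(p,0) = a and f(m,0) = 0 for m ≠ p; f(q,N) = b; for every n ≥ 1, f(m,n) = 0 unless m ∈ {−L, L} or (m,n) = (q,N); f(m,n) = 0 for all m whenever n > N; f is non-propagating; and y_f(m,n) = 0 for all m ∈ ℤ and all n > N. Then N ≥ 2L: the shortest possible single-impulse finite non-propagating excitation takes 2L time-steps. -/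
/-- Extension of a sequence to negative times by zero. -/
def extendByZero (g : ℕ → ℝ) (j : ℤ) : ℝ := if 0 ≤ j then g j.toNat else 0

theorem extendByZero_of_neg (g : ℕ → ℝ) {j : ℤ} (hj : j < 0) : extendByZero g j = 0 :=
  if_neg (by omega)

theorem extendByZero_of_lt {g : ℕ → ℝ} {N : ℕ} (hg : ∀ n, N < n → g n = 0) {j : ℤ}
    (hj : (N : ℤ) < j) : extendByZero g j = 0 := by
  rw [extendByZero, if_pos (by omega)]
  exact hg _ (by omega)

/-- Summing along a right-traveling characteristic a source located at the single site `x`. -/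
theorem sum_characteristic (g : ℕ → ℝ) (c x : ℤ) (n : ℕ) (h : x - c ≤ n) :
    ∑ k ∈ Finset.range (n + 1), (if c + (k : ℤ) = x then g k else 0) =
      extendByZero g (x - c) := by
  unfold extendByZero
  split_ifs with h0
  · rw [Finset.sum_eq_single_of_mem (x - c).toNat (Finset.mem_range.2 (by omega))]
    · exact if_pos (by omega)
    · intro k _ hk
      exact if_neg (by omega)
  · exact Finset.sum_eq_zero fun k _ => if_neg (by omega)

/-- Outside the region a non-propagating forcing has no net right-traveling component. -/
theorem NonProp.sum_right_eq_zero {L : ℕ} {f : ℤ × ℕ → ℝ} (h : NonProp L f)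
    (hsupp : ∀ m : ℤ, (L : ℤ) < |m| → ∀ n, f (m, n) = 0) (c : ℤ) (n : ℕ)
    (hc : (L : ℤ) < c + n) : ∑ k ∈ Finset.range (n + 1), f (c + k, k) = 0 := by
  have h1 := h (c + n) n (lt_of_lt_of_le hc (le_abs_self _))
  have h2 : ∑ k ∈ Finset.range (n + 1),
      (f (c + n - ((n - k : ℕ) : ℤ), k) + f (c + n + ((n - k : ℕ) : ℤ), k)) =
      ∑ k ∈ Finset.range (n + 1), f (c + k, k) := by
    refine Finset.sum_congr rfl fun k hk => ?_
    have hk' := Finset.mem_range.1 hk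
    rw [hsupp (c + n + ((n - k : ℕ) : ℤ)) (lt_of_lt_of_le (by omega) (le_abs_self _)), add_zero]
    congr 2
    omega
  rw [latticeY, h2] at h1
  linarith

theorem NonProp.reflect_s11 {L : ℕ} {f : ℤ × ℕ → ℝ} (h : NonProp L f) :
    NonProp L fun x => f (-x.1, x.2) := by
  intro m n hm
  rw [← h (-m) n (by rwa [abs_neg]), latticeY, latticeY]
  congr 1
  refine Finset.sum_congr rfl fun k _ => ?_
  rw [add_comm]
  congr 3 <;> ring

/-- The balance of the sources met by a right-traveling characteristic, indexed by the time `i`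
at which it reaches the right boundary. -/
theorem NonProp.balance_right {L : ℕ} {p q : ℤ} (hL : 1 ≤ L) (hp : |p| < (L : ℤ))
    (hq : |q| < (L : ℤ)) {N : ℕ} (hN : 1 ≤ N) {f : ℤ × ℕ → ℝ}
    (hf0 : ∀ m : ℤ, m ≠ p → f (m, 0) = 0)
    (hbd : ∀ n : ℕ, 1 ≤ n → ∀ m : ℤ,
      m ≠ -(L : ℤ) → m ≠ (L : ℤ) → (m, n) ≠ (q, N) → f (m, n) = 0)
    (h : NonProp L f) (i : ℤ) :
    extendByZero (fun n => f (L, n)) i + extendByZero (fun n => f (-L, n)) (i - 2 * L) +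
      (if i = L - p then f (p, 0) else 0) + (if i = L - q + N then f (q, N) else 0) = 0 := by
  rw [abs_lt] at hp hq
  have hsupp : ∀ m : ℤ, (L : ℤ) < |m| → ∀ n, f (m, n) = 0 := by
    intro m hm n
    rw [lt_abs] at hm
    rcases Nat.eq_zero_or_pos n with rfl | hn
    · exact hf0 m (by omega)
    · refine hbd n hn m (by omega) (by omega) fun e => ?_
      have := congrArg Prod.fst e
      simp only at this
      omega
  have hdecomp : ∀ (m : ℤ) (k : ℕ), f (m, k) =
      (if m = L then f (L, k) else 0) + (if m = -L then f (-L, k) else 0) +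
      (if m = p then (if k = 0 then f (p, 0) else 0) else 0) +
      (if m = q then (if k = N then f (q, N) else 0) else 0) := by
    intro m k
    rcases Nat.eq_zero_or_pos k with rfl | hk
    · have hLz : f ((L : ℤ), 0) = 0 := hf0 _ (by omega)
      have hLz' : f (-(L : ℤ), 0) = 0 := hf0 _ (by omega)
      have hN0 : (0 : ℕ) ≠ N := by omega
      by_cases hm : m = p
      · subst hm
        simp [hN0, hLz, hLz']
      · simp [hN0, hLz, hLz', hm, hf0 m hm]
    · have hk0 : k ≠ 0 := by omega
      by_cases h1 : m = L
      · have h2 : m ≠ -L := by omega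
        have h3 : m ≠ q := by omega
        subst h1
        simp [hk0, h2, h3]
      · by_cases h2 : m = -L
        · have h3 : m ≠ q := by omega
          subst h2
          simp [hk0, h1, h3]
        · by_cases h3 : m = q ∧ k = N
          · obtain ⟨rfl, rfl⟩ := h3
            simp [h1, h2, hk0]
          · rw [hbd k hk m h2 h1 (by simpa using h3)]
            simp only [h1, h2, hk0, if_false, ite_self, ← ite_and, h3]
            simp
  have hn : (L : ℤ) < (L - i) + ((L + L + i.toNat + 1 : ℕ) : ℤ) := by omega
  have key := h.sum_right_eq_zero hsupp (L - i) _ hn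
  rw [Finset.sum_congr rfl fun k _ => hdecomp _ k] at key
  simp only [Finset.sum_add_distrib] at key
  rw [sum_characteristic (fun k => f (L, k)) _ _ _ (by omega),
    sum_characteristic (fun k => f (-L, k)) _ _ _ (by omega),
    sum_characteristic (fun k => if k = 0 then f (p, 0) else 0) _ _ _ (by omega),
    sum_characteristic (fun k => if k = N then f (q, N) else 0) _ _ _ (by omega)] at key
  refine Eq.trans ?_ key
  congr 1
  · congr 1
    · congr 2 <;> ring
    · simp only [extendByZero]
      split_ifs <;> first | rfl | omega
  · simp only [extendByZero]
    split_ifs <;> first | rfl | omega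

/-- the shortest possible single-impulse finite non-propagating
excitation takes `2L` time-steps. -/
theorem shortest_finite_trap_takes_2L
    (L : ℕ) (hL : 1 ≤ L) (p q : ℤ) (hp : |p| < (L : ℤ)) (hq : |q| < (L : ℤ))
    (N : ℕ) (hN : 1 ≤ N) (a b : ℝ) (ha : a ≠ 0) (hb : b ≠ 0)
    (f : ℤ × ℕ → ℝ)
    (hf0 : f (p, 0) = a)
    (hf0' : ∀ m : ℤ, m ≠ p → f (m, 0) = 0)
    (hfq : f (q, N) = b)
    (hbd : ∀ n : ℕ, 1 ≤ n → ∀ m : ℤ,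
      m ≠ -(L : ℤ) → m ≠ (L : ℤ) → (m, n) ≠ (q, N) → f (m, n) = 0)
    (hoff : ∀ n : ℕ, N < n → ∀ m : ℤ, f (m, n) = 0)
    (hnp : NonProp L f)
    (hrest : ∀ m : ℤ, ∀ n : ℕ, N < n → latticeY f m n = 0) :
    2 * L ≤ N := by
  have hR := hnp.balance_right hL hp hq hN hf0' hbd
  have hS := hnp.reflect_s11.balance_right (f := fun x => f (-x.1, x.2)) (p := -p) (q := -q) hL (by rwa [abs_neg])
    (by rwa [abs_neg]) hN (fun m hm => hf0' _ (by omega))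
    (fun n hn m h1 h2 h3 => hbd n hn _ (by omega) (by omega) fun e => h3 (by
      simp only [Prod.mk.injEq] at e ⊢
      omega))
  simp only [neg_neg, hf0, hfq] at hR hS
  set U := extendByZero fun n => f (L, n)
  set V := extendByZero fun n => f (-L, n)
  have hU : ∀ j : ℤ, j < 0 ∨ (N : ℤ) < j → U j = 0 := fun j hj =>
    hj.elim (extendByZero_of_neg _) (extendByZero_of_lt fun n hn => hoff n hn _)
  have hV : ∀ j : ℤ, j < 0 ∨ (N : ℤ) < j → V j = 0 := fun j hj =>
    hj.elim (extendByZero_of_neg _) (extendByZero_of_lt fun n hn => hoff n hn _)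
  rw [abs_lt] at hp hq
  by_contra! hlt
  have right_cases : (p = q - N ∧ a + b = 0) ∨ (q + N = 2 * L - p ∧ a = b) := by
    have h1 := hR (L - p)
    rw [hV _ (by omega), if_pos rfl] at h1
    by_cases hc : (N : ℤ) < L - p
    · rw [hU _ (Or.inr hc)] at h1
      split_ifs at h1 with h2
      · exact Or.inl ⟨by omega, by linarith⟩
      · exact absurd (by linarith) ha
    · rw [if_neg (by omega)] at h1
      have h2 := hS (3 * L - p)
      rw [hV _ (by omega), if_neg (by omega), show (3 * L - p - 2 * L : ℤ) = L - p by ring] at h2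
      split_ifs at h2 with h3
      · exact Or.inr ⟨by omega, by linarith⟩
      · exact absurd (by linarith) ha
  have left_cases : (p = q + N ∧ a + b = 0) ∨ (N = 2 * L + p + q ∧ a = b) := by
    have h1 := hS (L - -p)
    rw [hU _ (by omega), if_pos rfl] at h1
    by_cases hc : (N : ℤ) < L - -p
    · rw [hV _ (Or.inr hc)] at h1
      split_ifs at h1 with h2
      · exact Or.inl ⟨by omega, by linarith⟩
      · exact absurd (by linarith) ha
    · rw [if_neg (by omega)] at h1
      have h2 := hR (3 * L + p)
      rw [hU _ (by omega), if_neg (by omega), show (3 * L + p - 2 * L : ℤ) = L - -p by ring] at h2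
      split_ifs at h2 with h3
      · exact Or.inr ⟨by omega, by linarith⟩
      · exact absurd (by linarith) ha
  rcases right_cases with ⟨h1, h2⟩ | ⟨h1, h2⟩ <;> rcases left_cases with ⟨h3, h4⟩ | ⟨h3, h4⟩
  · omega
  · exact ha (by linarith)
  · exact ha (by linarith)
  · omega
end

section
/- Let L ≥ 1 and p be integers with |p| < L and let a ≠ 0 be real. Define f : ℤ × ℕ → ℝ by f(p,0) = a, f(−L, L+p) = −a, f(L, L−p) = −a, f(−p, 2L) = a, and f = 0 at all other arguments. Then f is non-propagating, and y_f(m,n) = 0 for all m ∈ ℤ and all n ≥ 2L; i.e., this forcing realizes a single-impulse finite non-propagating excitation of duration exactly 2L, attaining the minimal possible duration. -/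
/-- The displacement at `(m, n)` caused by an impulse of size `c` at position `q` and time `t`. -/
theorem latticeY_impulse (q : ℤ) (t : ℕ) (c : ℝ) (m : ℤ) (n : ℕ) :
    latticeY (fun z => if z = (q, t) then c else 0) m n =
      (1 / 2) * ((if t ≤ n ∧ m - n = q - t then c else 0) +
        (if t ≤ n ∧ m + n = q + t then c else 0)) := by
  unfold latticeY
  by_cases ht : t ≤ n
  · rw [Finset.sum_eq_single_of_mem t (Finset.mem_range.2 (by omega))]
    · have h₁ : m - ((n - t : ℕ) : ℤ) = q ↔ m - n = q - t := by omega
      have h₂ : m + ((n - t : ℕ) : ℤ) = q ↔ m + n = q + t := by omega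
      simp only [Prod.mk.injEq, and_true, h₁, h₂, ht, true_and]
    · intro k _ hk
      simp [hk]
  · rw [Finset.sum_eq_zero]
    · simp [ht]
    · intro k hk
      have hkt : k ≠ t := by
        have := Finset.mem_range.1 hk
        omega
      simp [hkt]

theorem latticeY_add (f g : ℤ × ℕ → ℝ) (m : ℤ) (n : ℕ) :
    latticeY (fun z => f z + g z) m n = latticeY f m n + latticeY g m n := by
  simp only [latticeY, ← mul_add, ← Finset.sum_add_distrib]
  congr 1
  exact Finset.sum_congr rfl fun k _ => by ring

/-- the explicit four-impulse forcing realizes a single-impulse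
finite non-propagating excitation of minimal duration exactly `2L`. -/
theorem minimal_duration_trap_exists
    (L : ℕ) (hL : 1 ≤ L) (p : ℤ) (hp : |p| < (L : ℤ)) (a : ℝ) (ha : a ≠ 0)
    (f : ℤ × ℕ → ℝ)
    (hf : ∀ q : ℤ × ℕ,
      f q = if q = (p, 0) then a
        else if q = (-(L : ℤ), ((L : ℤ) + p).toNat) then -a
        else if q = ((L : ℤ), ((L : ℤ) - p).toNat) then -a
        else if q = (-p, 2 * L) then a
        else 0) :
    NonProp L f ∧ ∀ m : ℤ, ∀ n : ℕ, 2 * L ≤ n → latticeY f m n = 0 := by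
  obtain ⟨hp₁, hp₂⟩ := abs_lt.1 hp
  obtain ⟨u, hu⟩ : ∃ u : ℕ, u = ((L : ℤ) + p).toNat := ⟨_, rfl⟩
  obtain ⟨v, hv⟩ : ∃ v : ℕ, v = ((L : ℤ) - p).toNat := ⟨_, rfl⟩
  rw [← hu, ← hv] at hf
  have hu' : (u : ℤ) = L + p := by omega
  have hv' : (v : ℤ) = L - p := by omega
  have hsum : f = fun z => (((if z = (p, 0) then a else 0) +
      (if z = (-(L : ℤ), u) then -a else 0)) + (if z = ((L : ℤ), v) then -a else 0)) +
      (if z = (-p, 2 * L) then a else 0) := by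
    funext ⟨x, t⟩
    rw [hf]
    simp only [Prod.mk.injEq]
    split_ifs <;> first | omega | simp
  have key : ∀ (m : ℤ) (n : ℕ), (m < -L ∨ (L : ℤ) < m ∨ 2 * L ≤ n) → latticeY f m n = 0 := by
    intro m n h
    have h₁ : (0 ≤ n ∧ m - n = p - (0 : ℕ)) ↔ (v ≤ n ∧ m - n = L - v) := by omega
    have h₂ : (0 ≤ n ∧ m + n = p + (0 : ℕ)) ↔ (u ≤ n ∧ m + n = -L + u) := by omega
    have h₃ : (2 * L ≤ n ∧ m - n = -p - (2 * L : ℕ)) ↔ (u ≤ n ∧ m - n = -L - u) := by omega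
    have h₄ : (2 * L ≤ n ∧ m + n = -p + (2 * L : ℕ)) ↔ (v ≤ n ∧ m + n = L + v) := by omega
    have hneg : ∀ (P : Prop) [Decidable P], (if P then -a else 0) = -(if P then a else 0) := by
      intro P _
      split_ifs <;> simp
    rw [hsum]
    simp only [latticeY_add, latticeY_impulse]
    simp only [h₁, h₂, h₃, h₄, hneg]
    ring
  refine ⟨fun m n hm => key m n ?_, fun m n hn => key m n (Or.inr (Or.inr hn))⟩
  rcases lt_abs.1 hm with h | h <;> omega
end

section
/- Let x₀ ∈ ℤ, let p ≥ 1 be an integer, and let a ∈ ℝ. Define f : ℤ × ℕ → ℝ by f(x₀, 0) = a, f(x₀+p, p) = −a, and f = 0 elsewhere (an initial impulse together with a one-sided trap lagging by p time-steps). Then: (i) y_f(m,n) = 0 for all m > x₀+p and all n ∈ ℕ (no wave ever propagates to the right of the trapping point); and (ii) for every n ≥ p and every m, y_f(m,n) = (a/2) if m+n = x₀, −(a/2) if m+n = x₀+2p, and 0 otherwise: the excitation is purely left-traveling and exhibits self-interference of a sign-inverted copy at a phase lag of 2p time-steps. -/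
/-- Closed form of the displacement generated by an impulse `a` at `(x₀, 0)` and an
impulse `-a` at `(x₀ + p, p)`. -/
theorem latticeY_eq_of_impulse_trap
    (x₀ : ℤ) (p : ℕ) (hp : 1 ≤ p) (a : ℝ) (f : ℤ × ℕ → ℝ)
    (hf : ∀ m : ℤ, ∀ n : ℕ,
      f (m, n) = if m = x₀ ∧ n = 0 then a
        else if m = x₀ + (p : ℤ) ∧ n = p then -a else 0) (m : ℤ) (n : ℕ) :
    latticeY f m n = (1 / 2) *
      (((if m - n = x₀ then a else 0) + (if m + n = x₀ then a else 0)) +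
        if p ≤ n then
          (if m - n = x₀ then -a else 0) + (if m + n = x₀ + 2 * (p : ℤ) then -a else 0)
        else 0) := by
  have key : ∀ k ∈ Finset.range (n + 1),
      f (m - ((n - k : ℕ) : ℤ), k) + f (m + ((n - k : ℕ) : ℤ), k) =
        (if k = 0 then (if m - n = x₀ then a else 0) + (if m + n = x₀ then a else 0) else 0) +
        (if k = p then
          (if m - n = x₀ then -a else 0) + (if m + n = x₀ + 2 * (p : ℤ) then -a else 0)
        else 0) := by
    intro k hk
    have hkn : k ≤ n := Nat.lt_succ_iff.mp (Finset.mem_range.mp hk)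
    rw [hf, hf, Nat.cast_sub hkn]
    by_cases h0 : k = 0
    · subst h0
      have hp0 : 0 ≠ p := by lia
      simp [hp0]
    · by_cases h1 : k = p
      · subst h1
        have hr : m - ((n : ℤ) - k) = x₀ + k ↔ m - n = x₀ := by lia
        have hl : m + ((n : ℤ) - k) = x₀ + k ↔ m + n = x₀ + 2 * (k : ℤ) := by lia
        simp [h0, hr, hl]
      · simp [h0, h1]
  rw [latticeY, Finset.sum_congr rfl key, Finset.sum_add_distrib, Finset.sum_ite_eq',
    Finset.sum_ite_eq']
  simp

/-- an initial impulse with a one-sided trap lagging by `p`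
time-steps produces a purely left-traveling excitation with a sign-inverted
self-interference copy at phase lag `2p`; nothing propagates right of the trap. -/
theorem one_sided_trap_directional_emission
    (x₀ : ℤ) (p : ℕ) (hp : 1 ≤ p) (a : ℝ)
    (f : ℤ × ℕ → ℝ)
    (hf : ∀ m : ℤ, ∀ n : ℕ,
      f (m, n) = if m = x₀ ∧ n = 0 then a
        else if m = x₀ + (p : ℤ) ∧ n = p then -a else 0) :
    (∀ m : ℤ, ∀ n : ℕ, x₀ + (p : ℤ) < m → latticeY f m n = 0) ∧
    (∀ n : ℕ, p ≤ n → ∀ m : ℤ,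
      latticeY f m n =
        if m + (n : ℤ) = x₀ then a / 2
        else if m + (n : ℤ) = x₀ + 2 * (p : ℤ) then -a / 2 else 0) := by
  refine ⟨fun m n hm => ?_, fun n hn m => ?_⟩
  · rw [latticeY_eq_of_impulse_trap x₀ p hp a f hf]
    split_ifs <;> first | (exfalso; lia) | simp
  · rw [latticeY_eq_of_impulse_trap x₀ p hp a f hf, if_pos hn]
    split_ifs <;> first | (exfalso; lia) | ring
end

section
/- Let L be a positive integer and let w₀⁺, w₀⁻ : ℤ → ℝ be arbitrary initial right- and left-traveling wave profiles. Then there exists a forcing f : ℤ × ℕ → ℝ with f(m,n) = 0 for all m ∉ {−L, L} such that the total field y(m,n) = w₀⁺(m−n) + w₀⁻(m+n) + (1/2)·Σ_{k=0}^{n} ( f(m−(n−k),k) + f(m+(n−k),k) ) satisfies, for all n ∈ ℕ: for every m < −L, y(m,n) = w₀⁺(m−n) + (w₀⁻(m+n) if m+n < −L, else 0); and for every m > L, y(m,n) = w₀⁻(m+n) + (w₀⁺(m−n) if m−n > L, else 0). That is, the boundary forces act as a perfect absorber: every wave of the background field that enters the region |m| ≤ L never leaves it. -/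
/-- Forcing concentrated at `-L` and `L`, with amplitudes `a` and `b` respectively. -/
noncomputable def boundaryForce (L : ℕ) (a b : ℕ → ℝ) (p : ℤ × ℕ) : ℝ :=
  (if p.1 = -(L : ℤ) then a p.2 else 0) + (if p.1 = (L : ℤ) then b p.2 else 0)

/-- The amplitude at one boundary point that cancels the wave `u` arriving there together with the
signal emitted `2 * L` steps earlier from the opposite point, which absorbs `v`. -/
noncomputable def absorbingAmplitude (L : ℕ) (u v : ℕ → ℝ) (n : ℕ) : ℝ :=
  -2 * u n - if _h : 0 < L ∧ 2 * L ≤ n then absorbingAmplitude L v u (n - 2 * L) else 0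
termination_by n
decreasing_by omega

theorem absorbingAmplitude_add {L : ℕ} (hL : 0 < L) (u v : ℕ → ℝ) (n : ℕ) :
    absorbingAmplitude L u v n +
      (if 2 * L ≤ n then absorbingAmplitude L v u (n - 2 * L) else 0) = -2 * u n := by
  conv_lhs => enter [1]; rw [absorbingAmplitude]
  simp [hL]

theorem sum_range_ite_intCast_eq (g : ℕ → ℝ) {n : ℕ} {c : ℤ} (hc : c ≤ n) :
    ∑ k ∈ Finset.range (n + 1), (if (k : ℤ) = c then g k else 0) =
      if 0 ≤ c then g c.toNat else 0 := by
  split_ifs with h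
  · lift c to ℕ using h
    rw [Finset.sum_eq_single c]
    · simp
    · intro k _ hk
      simp [hk]
    · intro hcn
      simp only [Finset.mem_range] at hcn
      omega
  · exact Finset.sum_eq_zero fun k _ => if_neg (by omega)

theorem latticeY_boundaryForce_of_lt_neg (L : ℕ) (a b : ℕ → ℝ) {m : ℤ} (n : ℕ)
    (hm : m < -(L : ℤ)) :
    latticeY (boundaryForce L a b) m n = (1 / 2) *
      ((if 0 ≤ m + n + L then a (m + n + L).toNat else 0) +
        if 0 ≤ m + n - L then b (m + n - L).toNat else 0) := by
  rw [latticeY, ← sum_range_ite_intCast_eq a (n := n) (by omega),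
    ← sum_range_ite_intCast_eq b (n := n) (by omega), ← Finset.sum_add_distrib]
  congr 1
  refine Finset.sum_congr rfl fun k hk => ?_
  rw [Finset.mem_range] at hk
  simp only [boundaryForce]
  rw [if_neg (by omega), if_neg (by omega), add_zero, zero_add]
  congr 2 <;> exact propext (by omega)

theorem latticeY_boundaryForce_of_lt (L : ℕ) (a b : ℕ → ℝ) {m : ℤ} (n : ℕ)
    (hm : (L : ℤ) < m) :
    latticeY (boundaryForce L a b) m n = (1 / 2) *
      ((if 0 ≤ L - (m - n) then b (L - (m - n)).toNat else 0) +
        if 0 ≤ -L - (m - n) then a (-L - (m - n)).toNat else 0) := by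
  rw [latticeY, ← sum_range_ite_intCast_eq a (n := n) (by omega),
    ← sum_range_ite_intCast_eq b (n := n) (by omega), ← Finset.sum_add_distrib]
  congr 1
  refine Finset.sum_congr rfl fun k hk => ?_
  rw [Finset.mem_range] at hk
  simp only [boundaryForce]
  rw [if_neg (c := m + _ = _) (by omega), if_neg (c := m + _ = _) (by omega), add_zero, add_zero,
    add_comm]
  congr 2 <;> exact propext (by omega)

/-- boundary forces can act as a perfect absorber for an arbitrary
background field: every wave entering the region `|m| ≤ L` never leaves it. -/
theorem perfect_absorber_exists
    (L : ℕ) (hL : 1 ≤ L) (wp wm : ℤ → ℝ) :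
    ∃ f : ℤ × ℕ → ℝ,
      (∀ m : ℤ, ∀ n : ℕ, m ≠ -(L : ℤ) → m ≠ (L : ℤ) → f (m, n) = 0) ∧
      (∀ n : ℕ, ∀ m : ℤ,
        (m < -(L : ℤ) →
          wp (m - (n : ℤ)) + wm (m + (n : ℤ)) + latticeY f m n =
            wp (m - (n : ℤ)) +
              (if m + (n : ℤ) < -(L : ℤ) then wm (m + (n : ℤ)) else 0)) ∧
        ((L : ℤ) < m →
          wp (m - (n : ℤ)) + wm (m + (n : ℤ)) + latticeY f m n =
            wm (m + (n : ℤ)) +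
              (if (L : ℤ) < m - (n : ℤ) then wp (m - (n : ℤ)) else 0))) := by
  set u : ℕ → ℝ := fun j => wm (j - L) with hu
  set v : ℕ → ℝ := fun j => wp (L - j) with hv
  refine ⟨boundaryForce L (absorbingAmplitude L u v) (absorbingAmplitude L v u),
    fun m n h₁ h₂ => by simp [boundaryForce, h₁, h₂], fun n m => ⟨fun hm => ?_, fun hm => ?_⟩⟩
  · rw [latticeY_boundaryForce_of_lt_neg L _ _ n hm]
    by_cases h : m + (n : ℤ) < -(L : ℤ)
    · rw [if_pos h, if_neg (by omega), if_neg (by omega)]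
      ring
    · obtain ⟨j, hj⟩ := Int.eq_ofNat_of_zero_le (a := m + n + L) (by omega)
      have key := absorbingAmplitude_add hL u v j
      have hs : (j : ℤ) - L = m + n := by omega
      have hd : (m + n - L).toNat = j - 2 * L := by omega
      have hi : 0 ≤ m + n - L ↔ 2 * L ≤ j := by omega
      simp only [hu, hs] at key
      rw [if_neg h, if_pos (by omega), hj, Int.toNat_natCast, hd, if_congr hi rfl rfl, key]
      ring
  · rw [latticeY_boundaryForce_of_lt L _ _ n hm]
    by_cases h : (L : ℤ) < m - (n : ℤ)
    · rw [if_pos h, if_neg (by omega), if_neg (by omega)]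
      ring
    · obtain ⟨j, hj⟩ := Int.eq_ofNat_of_zero_le (a := L - (m - n)) (by omega)
      have key := absorbingAmplitude_add hL v u j
      have hs : (L : ℤ) - j = m - n := by omega
      have hd : (-L - (m - n)).toNat = j - 2 * L := by omega
      have hi : 0 ≤ -L - (m - n) ↔ 2 * L ≤ j := by omega
      simp only [hv, hs] at key
      rw [if_neg h, if_pos (by omega), hj, Int.toNat_natCast, hd, if_congr hi rfl rfl, key]
      ring
end

section
/- Let L ≥ 1 and p be integers with |p| < L and let a ≠ 0 be real. Define f : ℤ × ℕ → ℝ by f(p,0) = a, f(m,0) = 0 for m ≠ p, and for n ≥ 1: f(−L,n) = −a if n ≡ L+p (mod 4L), f(−L,n) = a if n ≡ 3L−p (mod 4L), f(−L,n) = 0 otherwise; f(L,n) = −a if n ≡ L−p (mod 4L), f(L,n) = a if n ≡ 3L+p (mod 4L), f(L,n) = 0 otherwise; and f(m,n) = 0 for n ≥ 1 and m ∉ {−L,L}. Then f is non-propagating: the single interior impulse together with this 4L-periodic series of boundary forces produces a field vanishing identically outside the region |m| ≤ L for all times. -/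
/-- Adding half a period to `x` swaps the two halves of the residue range. -/
theorem add_half_emod_cases {l : ℤ} (hl : 0 < l) (x : ℤ) :
    (x % (4 * l) < 2 * l ∧ (x + 2 * l) % (4 * l) = x % (4 * l) + 2 * l) ∨
      (2 * l ≤ x % (4 * l) ∧ (x + 2 * l) % (4 * l) = x % (4 * l) - 2 * l) := by
  have h0 := Int.emod_nonneg x (show 4 * l ≠ 0 by omega)
  have h1 := Int.emod_lt_of_pos x (show 0 < 4 * l by omega)
  have h2 : (x + 2 * l) % (4 * l) = (x % (4 * l) + 2 * l) % (4 * l) := by simp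
  rw [h2]
  rcases lt_or_ge (x % (4 * l)) (2 * l) with h | h
  · exact Or.inl ⟨h, Int.emod_eq_of_lt (by omega) (by omega)⟩
  · refine Or.inr ⟨h, ?_⟩
    rw [show x % (4 * l) + 2 * l = x % (4 * l) - 2 * l + 4 * l by ring, Int.add_emod_right]
    exact Int.emod_eq_of_lt (by omega) (by omega)

/-- The right-traveling components of the periodic boundary forcing cancel along every
characteristic that has left the region through its right end. -/
theorem sum_right_characteristic_eq_zero
    (L : ℕ) (p : ℤ) (hp : |p| < (L : ℤ)) (a : ℝ) (f : ℤ × ℕ → ℝ)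
    (hf0 : f (p, 0) = a)
    (hf0' : ∀ m : ℤ, m ≠ p → f (m, 0) = 0)
    (hfL : ∀ n : ℕ, 1 ≤ n →
      f (-(L : ℤ), n) =
        if (n : ℤ) % (4 * L) = ((L : ℤ) + p) % (4 * L) then -a
        else if (n : ℤ) % (4 * L) = (3 * (L : ℤ) - p) % (4 * L) then a
        else 0)
    (hfR : ∀ n : ℕ, 1 ≤ n →
      f ((L : ℤ), n) =
        if (n : ℤ) % (4 * L) = ((L : ℤ) - p) % (4 * L) then -a
        else if (n : ℤ) % (4 * L) = (3 * (L : ℤ) + p) % (4 * L) then a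
        else 0)
    (hbd : ∀ n : ℕ, 1 ≤ n → ∀ m : ℤ, m ≠ -(L : ℤ) → m ≠ (L : ℤ) → f (m, n) = 0)
    (c : ℤ) (n : ℕ) (hn : (L : ℤ) < c + n) :
    ∑ k ∈ Finset.range (n + 1), f (c + k, k) = 0 := by
  obtain ⟨hp1, hp2⟩ := abs_lt.1 hp
  have hzero : ∀ k : ℕ, (k = 0 → c ≠ p) → (k ≠ 0 → c + k ≠ -L ∧ c + k ≠ L) →
      f (c + k, k) = 0 := by
    intro k h0 h1
    rcases Nat.eq_zero_or_pos k with rfl | hk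
    · simpa using hf0' c (h0 rfl)
    · exact hbd k hk _ (h1 hk.ne').1 (h1 hk.ne').2
  have e1 : ((L : ℤ) + p) % (4 * L) = L + p := Int.emod_eq_of_lt (by omega) (by omega)
  have e2 : (3 * (L : ℤ) - p) % (4 * L) = 3 * L - p := Int.emod_eq_of_lt (by omega) (by omega)
  have e3 : ((L : ℤ) - p) % (4 * L) = L - p := Int.emod_eq_of_lt (by omega) (by omega)
  have e4 : (3 * (L : ℤ) + p) % (4 * L) = 3 * L + p := Int.emod_eq_of_lt (by omega) (by omega)
  simp only [e1, e2, e3, e4] at hfL hfR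
  rcases le_or_gt (L : ℤ) c with hc | hc
  · exact Finset.sum_eq_zero fun k _ => hzero k (by omega) (by omega)
  obtain ⟨j, hj⟩ : ∃ j : ℕ, (j : ℤ) = L - c := ⟨(L - c).toNat, by omega⟩
  have hcj : c + j = L := by omega
  rcases le_or_gt (-(L : ℤ)) c with hc' | hc'
  · rw [Finset.sum_eq_add_of_mem 0 j (by simp) (by simp; omega) (by omega)
      fun k _ hk => hzero k (by omega) (by omega), hcj, hfR j (by omega),
      Int.emod_eq_of_lt (by omega) (by omega)]
    rcases eq_or_ne c p with rfl | hcp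
    · simp [hf0, hj]
    · rw [if_neg (by omega), if_neg (by omega)]
      simpa using hf0' c hcp
  · obtain ⟨i, hi⟩ : ∃ i : ℕ, (i : ℤ) = -L - c := ⟨(-L - c).toNat, by omega⟩
    rw [Finset.sum_eq_add_of_mem i j (by simp; omega) (by simp; omega) (by omega)
      fun k _ hk => hzero k (by omega) (by omega), hcj, show c + i = -L by omega,
      hfL i (by omega), hfR j (by omega), show (j : ℤ) = i + 2 * L by omega]
    have h0 := Int.emod_nonneg (i : ℤ) (show 4 * (L : ℤ) ≠ 0 by omega)
    have h1 := Int.emod_lt_of_pos (i : ℤ) (show 0 < 4 * (L : ℤ) by omega)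
    have h2 := add_half_emod_cases (show 0 < (L : ℤ) by omega) (i : ℤ)
    split_ifs <;> first | (exfalso; omega) | ring

/-- the single interior impulse at `(p,0)` together with the
explicit `4L`-periodic series of boundary forces is non-propagating. -/
theorem periodic_boundary_forces_trap
    (L : ℕ) (hL : 1 ≤ L) (p : ℤ) (hp : |p| < (L : ℤ)) (a : ℝ) (ha : a ≠ 0)
    (f : ℤ × ℕ → ℝ)
    (hf0 : f (p, 0) = a)
    (hf0' : ∀ m : ℤ, m ≠ p → f (m, 0) = 0)
    (hfL : ∀ n : ℕ, 1 ≤ n →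
      f (-(L : ℤ), n) =
        if (n : ℤ) % (4 * L) = ((L : ℤ) + p) % (4 * L) then -a
        else if (n : ℤ) % (4 * L) = (3 * (L : ℤ) - p) % (4 * L) then a
        else 0)
    (hfR : ∀ n : ℕ, 1 ≤ n →
      f ((L : ℤ), n) =
        if (n : ℤ) % (4 * L) = ((L : ℤ) - p) % (4 * L) then -a
        else if (n : ℤ) % (4 * L) = (3 * (L : ℤ) + p) % (4 * L) then a
        else 0)
    (hbd : ∀ n : ℕ, 1 ≤ n → ∀ m : ℤ, m ≠ -(L : ℤ) → m ≠ (L : ℤ) → f (m, n) = 0) :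
    NonProp L f := by
  have hp' := abs_lt.1 hp
  have hzero : ∀ (m : ℤ) (k : ℕ), (L : ℤ) < |m| → f (m, k) = 0 := by
    intro m k hm
    rcases Nat.eq_zero_or_pos k with rfl | hk
    · exact hf0' m (by rintro rfl; omega)
    · exact hbd k hk m (by rintro rfl; simp at hm) (by rintro rfl; simp at hm)
  intro m n hm
  rw [latticeY, Finset.sum_add_distrib]
  suffices h : ∑ k ∈ Finset.range (n + 1), f (m - ((n - k : ℕ) : ℤ), k) = 0 ∧
      ∑ k ∈ Finset.range (n + 1), f (m + ((n - k : ℕ) : ℤ), k) = 0 by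
    rw [h.1, h.2]; simp
  rcases lt_abs.1 hm with h | h
  · constructor
    · rw [← sum_right_characteristic_eq_zero L p hp a f hf0 hf0' hfL hfR hbd (m - n) n (by omega)]
      refine Finset.sum_congr rfl fun k hk => ?_
      rw [Finset.mem_range] at hk
      congr 2
      omega
    · exact Finset.sum_eq_zero fun k _ => hzero _ k (lt_abs.2 (by omega))
  · constructor
    · exact Finset.sum_eq_zero fun k _ => hzero _ k (lt_abs.2 (by omega))
    · rw [← sum_right_characteristic_eq_zero L (-p) (by rwa [abs_neg]) a (fun x => f (-x.1, x.2))
        (by simpa using hf0) (fun m hm => hf0' (-m) (by omega))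
        (fun k hk => by simpa [sub_eq_add_neg] using hfR k hk)
        (fun k hk => by simpa [sub_eq_add_neg] using hfL k hk)
        (fun k hk m h1 h2 => hbd k hk (-m) (by omega) (by omega)) (-m - n) n (by omega)]
      refine Finset.sum_congr rfl fun k hk => ?_
      rw [Finset.mem_range] at hk
      congr 2
      push_cast [Nat.cast_sub (Nat.lt_succ_iff.1 hk)]
      ring
end
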